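/- Invariance principle (Mossel–O'Donnell–Oleszkiewicz, cdf version): there is a universal constant C > 0 such that the following holds. Let d ≥ 1 and let Q(u_1,…,u_n) = Σ_{S ⊆ [n], |S| ≤ d} c_S ∏_{i∈S} u_i be a multilinear polynomial with Σ_{S ≠ ∅} c_S^2 = 1, and set τ := max_{i∈[n]} Σ_{S ∋ i} c_S^2. Let X_1,…,X_n be independent uniform ±1 random variables and G_1,…,G_n independent standard Gaussians. Then for every t ∈ ℝ, |Pr[Q(X_1,…,X_n) ≤ t] − Pr[Q(G_1,…,G_n) ≤ t]| ≤ C · d · (10^d · τ)^{1/(4d+1)}. -/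

import Mathlib

open Finset

/-- The real value of a cube coordinate: `true ↦ 1`, `false ↦ -1`. -/
noncomputable def bR (b : Bool) : ℝ := if b then 1 else -1

/-- Expectation over a uniformly random point of the cube `{-1,1}ⁿ`. -/
noncomputable def expect {n : ℕ} (g : (Fin n → Bool) → ℝ) : ℝ :=
  (∑ x : Fin n → Bool, g x) / 2 ^ n

/-- The character `χ_S(x) = ∏_{i ∈ S} x i`. -/
noncomputable def chi {n : ℕ} (S : Finset (Fin n)) (x : Fin n → Bool) : ℝ :=
  ∏ i ∈ S, bR (x i)

/-- The Fourier coefficient `f̂(S) = E[f(x) χ_S(x)]`. -/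
noncomputable def fhat {n : ℕ} (f : (Fin n → Bool) → ℝ) (S : Finset (Fin n)) : ℝ :=
  expect fun x => f x * chi S x

open MeasureTheory ProbabilityTheory

/-- The standard Gaussian measure on `ℝⁿ` (product of standard one-dimensional
Gaussians). -/
noncomputable def gaussianPi (n : ℕ) : Measure (Fin n → ℝ) :=
  Measure.pi fun _ : Fin n => gaussianReal 0 1

lemma lintegral_sqrt_div_abs_le (x a : ℝ) (ha : 0 < a) :
    ∫⁻ t in {t : ℝ | |t - x| < a}, ENNReal.ofReal (√(a / |t - x|)) ≤ ENNReal.ofReal (4 * a) := by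
  have half : ∫⁻ t in Set.Ioc 0 a, ENNReal.ofReal (√(a / t)) = ENNReal.ofReal (2 * a) := by
    have hint : IntervalIntegrable (fun t : ℝ => √a * t ^ (-(1 / 2) : ℝ)) volume 0 a :=
      (intervalIntegral.intervalIntegrable_rpow' (by norm_num)).const_mul _
    have hcongr : ∀ t ∈ Set.Ioc 0 a, ENNReal.ofReal (√(a / t))
        = ENNReal.ofReal (√a * t ^ (-(1 / 2) : ℝ)) := by
      intro t ht
      rw [Real.sqrt_div ha.le, Real.rpow_neg ht.1.le, Real.sqrt_eq_rpow t, div_eq_mul_inv]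
    rw [setLIntegral_congr_fun measurableSet_Ioc hcongr,
      ← ofReal_integral_eq_lintegral_ofReal
        ((intervalIntegrable_iff_integrableOn_Ioc_of_le ha.le).1 hint)]
    · rw [← intervalIntegral.integral_of_le ha.le, intervalIntegral.integral_const_mul,
        integral_rpow (by norm_num)]
      congr 1
      have : √a * √a = a := Real.mul_self_sqrt ha.le
      rw [show (-(1 / 2) + 1 : ℝ) = 1 / 2 by norm_num, ← Real.sqrt_eq_rpow,
        ← Real.sqrt_eq_rpow, Real.sqrt_zero]
      nlinarith
    · filter_upwards [ae_restrict_mem measurableSet_Ioc] with t ht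
      exact mul_nonneg (Real.sqrt_nonneg _) (Real.rpow_nonneg ht.1.le _)
  have hpos : ∫⁻ t in Set.Ioc x (x + a), ENNReal.ofReal (√(a / |t - x|))
      = ENNReal.ofReal (2 * a) := by
    rw [← half, ← lintegral_indicator measurableSet_Ioc, ← lintegral_indicator measurableSet_Ioc,
      ← lintegral_add_right_eq_self _ x]
    refine lintegral_congr fun t => ?_
    simp only [Set.indicator, Set.mem_Ioc]
    by_cases h : 0 < t ∧ t ≤ a
    · rw [if_pos h, if_pos ⟨by linarith, by linarith⟩, add_sub_cancel_right, abs_of_pos h.1]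
    · rw [if_neg h, if_neg]
      rintro ⟨h1, h2⟩
      exact h ⟨by linarith, by linarith⟩
  have hneg : ∫⁻ t in Set.Ico (x - a) x, ENNReal.ofReal (√(a / |t - x|))
      = ENNReal.ofReal (2 * a) := by
    rw [← half, ← lintegral_indicator measurableSet_Ico, ← lintegral_indicator measurableSet_Ioc,
      ← lintegral_sub_left_eq_self _ x]
    refine lintegral_congr fun t => ?_
    simp only [Set.indicator, Set.mem_Ioc, Set.mem_Ico]
    by_cases h : 0 < t ∧ t ≤ a
    · rw [if_pos h, if_pos ⟨by linarith, by linarith⟩, show x - t - x = -t by ring, abs_neg,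
        abs_of_pos h.1]
    · rw [if_neg h, if_neg]
      rintro ⟨h1, h2⟩
      exact h ⟨by linarith, by linarith⟩
  have hsub : {t : ℝ | |t - x| < a} ⊆ (Set.Ioc x (x + a) ∪ Set.Ico (x - a) x) ∪ {x} := by
    intro t ht
    have := abs_lt.1 (show |t - x| < a from ht)
    rcases lt_trichotomy t x with h | h | h
    · exact Or.inl (Or.inr ⟨by linarith, h⟩)
    · exact Or.inr h
    · exact Or.inl (Or.inl ⟨h, by linarith⟩)
  calc _ ≤ _ := lintegral_mono_set hsub
    _ ≤ _ := lintegral_union_le _ _ _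
    _ ≤ (_ + _) + _ := add_le_add_left (lintegral_union_le _ _ _) _
    _ = _ := by
      rw [hpos, hneg, Measure.restrict_singleton]
      simp only [Real.volume_singleton, zero_smul, lintegral_zero_measure, add_zero]
      rw [← ENNReal.ofReal_add (by linarith) (by linarith)]
      congr 1; ring

/-- One root, against the uniform weight on `E`, seen from the far side of `c`. -/
lemma lintegral_sqrt_root_le {E : Set ℝ} (hE : MeasurableSet E) {ε c ℓ x : ℝ}
    (hε : ε = 1 ∨ ε = -1) (hℓ : 0 < ℓ) (hvol : volume E = ENNReal.ofReal ℓ)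
    (hside : ∀ s ∈ E, ε * (s - c) ≤ 0) :
    ∫⁻ s in E, ENNReal.ofReal (√(max (ε * (x - c)) ℓ / |s - x|)) ≤ ENNReal.ofReal (5 * ℓ) := by
  rcases le_or_gt (ε * (x - c)) ℓ with hb | hb
  · rw [max_eq_right hb]
    have hm : MeasurableSet {s : ℝ | |s - x| < ℓ} := measurableSet_lt (by fun_prop) (by fun_prop)
    have hle : ∀ s, ENNReal.ofReal (√(ℓ / |s - x|)) ≤
        ({s : ℝ | |s - x| < ℓ}.indicator (fun s => ENNReal.ofReal (√(ℓ / |s - x|))) s) + 1 := by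
      intro s
      by_cases h : |s - x| < ℓ
      · rw [Set.indicator_of_mem (by exact h)]; exact le_self_add
      · rw [Set.indicator_of_notMem (by exact h), zero_add]
        push Not at h
        refine ENNReal.ofReal_le_one.2 (Real.sqrt_le_one.2 ?_)
        exact div_le_one_of_le₀ h (abs_nonneg _)
    calc _ ≤ _ := lintegral_mono hle
      _ = _ := lintegral_add_right _ measurable_const
      _ ≤ ENNReal.ofReal (4 * ℓ) + ENNReal.ofReal ℓ := by
        refine add_le_add ?_ (by simp [hvol])
        refine (setLIntegral_le_lintegral _ _).trans ?_
        rw [lintegral_indicator hm]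
        exact lintegral_sqrt_div_abs_le x ℓ hℓ
      _ = _ := by rw [← ENNReal.ofReal_add (by linarith) hℓ.le]; congr 1; ring
  · rw [max_eq_left hb.le]
    calc _ ≤ ∫⁻ s in E, 1 := by
          refine setLIntegral_mono' hE fun s hs => ENNReal.ofReal_le_one.2 (Real.sqrt_le_one.2 ?_)
          refine div_le_one_of_le₀ ?_ (abs_nonneg _)
          have h1 := hside s hs
          rcases hε with rfl | rfl
          · rw [abs_sub_comm]; exact le_trans (by linarith) (le_abs_self _)
          · exact le_trans (by linarith) (le_abs_self _)
      _ ≤ _ := by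
        simp only [lintegral_const, one_mul, Measure.restrict_apply MeasurableSet.univ,
          Set.univ_inter, hvol]
        exact ENNReal.ofReal_le_ofReal (by linarith)

/-- One root, against the weight `|t - c|` on `E`. -/
lemma lintegral_sqrt_root_mul_le {E : Set ℝ} {ε c ℓ x β J : ℝ}
    (hε : ε = 1 ∨ ε = -1) (hvol : volume E = ENNReal.ofReal ℓ)
    (hβ : 0 < β) (hβℓ : ℓ ≤ β) (hβx : ε * (x - c) ≤ β) (hJ : 0 < J)
    (hJE : ∫⁻ t in E, ENNReal.ofReal (ε * (t - c)) = ENNReal.ofReal J) :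
    ∫⁻ t in E, ENNReal.ofReal (√(J / β / |t - x|)) * ENNReal.ofReal (ε * (t - c)) ≤
      ENNReal.ofReal (6 * J) := by
  set a := J / β with ha_def
  have ha : 0 < a := div_pos hJ hβ
  have haβ : a * β = J := div_mul_cancel₀ _ hβ.ne'
  have hm : MeasurableSet {s : ℝ | |s - x| < a} := measurableSet_lt (by fun_prop) (by fun_prop)
  have hle : ∀ t, ENNReal.ofReal (√(a / |t - x|)) * ENNReal.ofReal (ε * (t - c)) ≤
      ENNReal.ofReal (ε * (t - c)) + (ENNReal.ofReal a +
        ENNReal.ofReal β *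
        ({s : ℝ | |s - x| < a}.indicator (fun s => ENNReal.ofReal (√(a / |s - x|))) t)) := by
    intro t
    by_cases h : |t - x| < a
    · rw [Set.indicator_of_mem (by exact h)]
      refine le_trans ?_ le_add_self
      rw [← ENNReal.ofReal_mul (Real.sqrt_nonneg _), ← ENNReal.ofReal_mul hβ.le,
        ← ENNReal.ofReal_add ha.le (by positivity)]
      refine ENNReal.ofReal_le_ofReal ?_
      have h1 : ε * (t - c) ≤ |t - x| + β := by
        have : ε * (t - x) ≤ |t - x| := by
          rcases hε with rfl | rfl
          · rw [one_mul]; exact le_abs_self _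
          · rw [neg_one_mul]; exact neg_le_abs _
        nlinarith
      have h2 : √(a / |t - x|) * |t - x| ≤ a := by
        rcases (abs_nonneg (t - x)).eq_or_lt with h0 | h0
        · rw [← h0]; simpa using ha.le
        · have : √(a / |t - x|) * |t - x| = √(a * |t - x|) := by
            rw [Real.sqrt_div ha.le, Real.sqrt_mul ha.le]
            have := Real.mul_self_sqrt h0.le
            have h4 : 0 < √|t - x| := Real.sqrt_pos.2 h0
            field_simp
            rw [sq, this]
          rw [this]
          exact Real.sqrt_le_iff.2 ⟨ha.le, by nlinarith⟩
      nlinarith [Real.sqrt_nonneg (a / |t - x|)]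
    · refine le_trans ?_ le_self_add
      push Not at h
      refine mul_le_of_le_one_left zero_le (ENNReal.ofReal_le_one.2 (Real.sqrt_le_one.2 ?_))
      exact div_le_one_of_le₀ h (abs_nonneg _)
  calc _ ≤ _ := lintegral_mono hle
    _ = ENNReal.ofReal J + (ENNReal.ofReal a * ENNReal.ofReal ℓ + ENNReal.ofReal β *
        ∫⁻ t in E, ({s : ℝ | |s - x| < a}.indicator
          (fun s => ENNReal.ofReal (√(a / |s - x|))) t)) := by
      rw [lintegral_add_left (by fun_prop), lintegral_add_left (by fun_prop),
        lintegral_const_mul _ (Measurable.indicator (by fun_prop) hm), hJE]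
      simp [hvol]
    _ ≤ ENNReal.ofReal J + (ENNReal.ofReal J + ENNReal.ofReal β * ENNReal.ofReal (4 * a)) := by
      gcongr
      · rw [← ENNReal.ofReal_mul ha.le]
        refine ENNReal.ofReal_le_ofReal ?_
        nlinarith
      · refine (setLIntegral_le_lintegral _ _).trans ?_
        rw [lintegral_indicator hm]
        exact lintegral_sqrt_div_abs_le x a ha
    _ = _ := by
      rw [← ENNReal.ofReal_mul hβ.le, ← ENNReal.ofReal_add hJ.le (by positivity),
        ← ENNReal.ofReal_add hJ.le (by positivity)]
      congr 1; nlinarith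

/-- A Chebyshev-type estimate: a product of distances to `card ι` roots that is at most `Λ` on two
sets of equal length separated by `c` controls the first moment about `c`. -/
lemma pow_card_le_of_prod_norm_le {ι : Type*} [Fintype ι] (z : ι → ℂ) {E₁ E₂ : Set ℝ}
    (hE₁ : MeasurableSet E₁) (hE₂ : MeasurableSet E₂) {ε c ℓ J Λ : ℝ}
    (hε : ε = 1 ∨ ε = -1) (hℓ : 0 < ℓ)
    (hvol₁ : volume E₁ = ENNReal.ofReal ℓ) (hvol₂ : volume E₂ = ENNReal.ofReal ℓ)
    (hside : ∀ s ∈ E₁, ε * (s - c) ≤ 0) (hJ : 0 < J)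
    (hJE : ∫⁻ t in E₂, ENNReal.ofReal (ε * (t - c)) = ENNReal.ofReal J)
    (hΛ₁ : ∀ s ∈ E₁, ∏ i, ‖(s : ℂ) - z i‖ ≤ Λ) (hΛ₂ : ∀ s ∈ E₂, ∏ i, ‖(s : ℂ) - z i‖ ≤ Λ) :
    J ^ Fintype.card ι ≤ Real.exp (22 * Fintype.card ι) * Λ ^ 2 := by
  set m := Fintype.card ι with hm
  set β : ι → ℝ := fun i => max (ε * ((z i).re - c)) ℓ with hβdef
  have hβ : ∀ i, 0 < β i := fun i => lt_max_of_lt_right hℓ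
  set N : Set ℝ := Set.range fun i => (z i).re with hN
  have hN0 : volume N = 0 := (Set.finite_range _).measure_zero _
  obtain ⟨s, hsN, hs⟩ : ∃ s, s ∉ E₁ᶜ ∪ N ∧
      ∑ i, ENNReal.ofReal (√(β i / |s - (z i).re|)) ≤ ENNReal.ofReal (5 * m) := by
    have h0 : volume.restrict E₁ ≠ 0 := by
      rw [Ne, Measure.restrict_eq_zero, hvol₁]; simpa using hℓ
    have hnull : (volume.restrict E₁) (E₁ᶜ ∪ N) = 0 := by
      refine measure_union_null ?_ ?_
      · rw [Measure.restrict_apply hE₁.compl]; simp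
      · exact le_antisymm ((Measure.restrict_apply_le _ _).trans hN0.le) zero_le
    have : IsFiniteMeasure (volume.restrict E₁) := ⟨by simp [hvol₁]⟩
    obtain ⟨s, hs, hs'⟩ := exists_notMem_null_le_laverage
      (f := fun s => ∑ i, ENNReal.ofReal (√(β i / |s - (z i).re|))) h0
      (by fun_prop) hnull
    refine ⟨s, hs, hs'.trans ?_⟩
    rw [laverage_eq, Measure.restrict_apply_univ, hvol₁]
    refine ENNReal.div_le_of_le_mul ?_
    rw [lintegral_finsetSum _ (by fun_prop)]
    calc _ ≤ ∑ i : ι, ENNReal.ofReal (5 * ℓ) :=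
          Finset.sum_le_sum fun i _ => lintegral_sqrt_root_le hE₁ hε hℓ hvol₁ hside
      _ = _ := by
        rw [Finset.sum_const, Finset.card_univ, ← hm, nsmul_eq_mul, ← ENNReal.ofReal_mul (by positivity),
          ← ENNReal.ofReal_natCast, ← ENNReal.ofReal_mul (by positivity)]
        congr 1; ring
  obtain ⟨t, htN, ht⟩ : ∃ t, t ∉ E₂ᶜ ∪ N ∧
      ∑ i, ENNReal.ofReal (√(J / β i / |t - (z i).re|)) ≤ ENNReal.ofReal (6 * m) := by
    set ν := (volume.restrict E₂).withDensity (fun t => ENNReal.ofReal (ε * (t - c))) with hν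
    have hνu : ν Set.univ = ENNReal.ofReal J := by
      rw [hν, withDensity_apply _ MeasurableSet.univ, Measure.restrict_univ, hJE]
    have h0 : ν ≠ 0 := by
      intro h
      rw [h] at hνu
      simp at hνu
      linarith
    have hnull : ν (E₂ᶜ ∪ N) = 0 := by
      refine withDensity_absolutelyContinuous _ _ ?_
      refine measure_union_null ?_ ?_
      · rw [Measure.restrict_apply hE₂.compl]; simp
      · exact le_antisymm ((Measure.restrict_apply_le _ _).trans hN0.le) zero_le
    have : IsFiniteMeasure ν := ⟨by simp [hνu]⟩
    obtain ⟨s, hs, hs'⟩ := exists_notMem_null_le_laverage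
      (f := fun s => ∑ i, ENNReal.ofReal (√(J / β i / |s - (z i).re|))) h0
      (by fun_prop) hnull
    refine ⟨s, hs, hs'.trans ?_⟩
    rw [laverage_eq, hνu]
    refine ENNReal.div_le_of_le_mul ?_
    rw [lintegral_finsetSum _ (by fun_prop)]
    calc _ ≤ ∑ i : ι, ENNReal.ofReal (6 * J) := by
          refine Finset.sum_le_sum fun i _ => ?_
          rw [hν, lintegral_withDensity_eq_lintegral_mul _ (by fun_prop) (by fun_prop)]
          refine le_trans (le_of_eq ?_) (lintegral_sqrt_root_mul_le (x := (z i).re) hε hvol₂ (hβ i)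
            (le_max_right _ _) (le_max_left _ _) hJ hJE)
          exact lintegral_congr fun t => by simp [mul_comm]
      _ = _ := by
        rw [Finset.sum_const, Finset.card_univ, ← hm, nsmul_eq_mul, ← ENNReal.ofReal_mul (by positivity),
          ← ENNReal.ofReal_natCast, ← ENNReal.ofReal_mul (by positivity)]
        congr 1; ring
  simp only [Set.mem_union, Set.mem_compl_iff, not_or, not_not] at hsN htN
  rw [← ENNReal.ofReal_sum_of_nonneg (fun _ _ => Real.sqrt_nonneg _),
    ENNReal.ofReal_le_ofReal_iff (by positivity)] at hs ht
  have hpos : ∀ u, u ∉ N → ∀ i, 0 < |u - (z i).re| := fun u hu i =>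
    abs_pos.2 (sub_ne_zero.2 fun h => hu ⟨i, h.symm⟩)
  have key : ∏ i, √(β i / |s - (z i).re|) * √(J / β i / |t - (z i).re|) ≤
      Real.exp (11 * m) := by
    calc _ ≤ ∏ i, Real.exp (√(β i / |s - (z i).re|) + √(J / β i / |t - (z i).re|)) := by
          refine Finset.prod_le_prod (fun i _ => by positivity) fun i _ => ?_
          rw [Real.exp_add]
          have h1 := Real.add_one_le_exp (√(β i / |s - (z i).re|))
          have h2 := Real.add_one_le_exp (√(J / β i / |t - (z i).re|))
          exact mul_le_mul (by linarith) (by linarith) (Real.sqrt_nonneg _) (Real.exp_nonneg _)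
      _ ≤ _ := by
        rw [← Real.exp_sum, Finset.sum_add_distrib]
        exact Real.exp_le_exp.2 (by linarith)
  have hsq : (∏ i, √(β i / |s - (z i).re|) * √(J / β i / |t - (z i).re|)) ^ 2 *
      ((∏ i, |s - (z i).re|) * ∏ i, |t - (z i).re|) = J ^ m := by
    rw [← Finset.prod_pow, ← Finset.prod_mul_distrib, ← Finset.prod_mul_distrib, hm,
      ← Finset.card_univ, ← Finset.prod_const]
    refine Finset.prod_congr rfl fun i _ => ?_
    have h1 := hpos s hsN.2 i
    have h2 := hpos t htN.2 i
    have h3 := hβ i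
    rw [mul_pow, Real.sq_sqrt (by positivity), Real.sq_sqrt (by positivity)]
    field_simp
  have hdist : ∀ u : ℝ, ∏ i, |u - (z i).re| ≤ ∏ i, ‖(u : ℂ) - z i‖ := fun u =>
    Finset.prod_le_prod (fun i _ => abs_nonneg _) fun i _ => by
      have := Complex.abs_re_le_norm ((u : ℂ) - z i)
      simpa using this
  have hs2 := (hdist s).trans (hΛ₁ s hsN.1)
  have ht2 := (hdist t).trans (hΛ₂ t htN.1)
  have hs0 : 0 ≤ ∏ i, |s - (z i).re| := Finset.prod_nonneg fun _ _ => abs_nonneg _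
  have ht0 : 0 ≤ ∏ i, |t - (z i).re| := Finset.prod_nonneg fun _ _ => abs_nonneg _
  rw [← hsq, sq Λ]
  have h22 : Real.exp (22 * m) = Real.exp (11 * m) ^ 2 := by
    rw [← Real.exp_nat_mul]; congr 1; push_cast; ring
  rw [h22]
  have hk0 : 0 ≤ ∏ i, √(β i / |s - (z i).re|) * √(J / β i / |t - (z i).re|) :=
    Finset.prod_nonneg fun _ _ => by positivity
  refine mul_le_mul (pow_le_pow_left₀ hk0 key 2) (mul_le_mul hs2 ht2 ht0 (hs0.trans hs2))
    (mul_nonneg hs0 ht0) (by positivity)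

lemma lintegral_sub_le_of_prod_norm_le {d : ℕ} (hd : 1 ≤ d) (z : Fin (2 * d) → ℂ) {E₁ E₂ : Set ℝ}
    (hE₁ : MeasurableSet E₁) (hE₂ : MeasurableSet E₂) {ε c ℓ lam M : ℝ}
    (hε : ε = 1 ∨ ε = -1) (hℓ : 0 < ℓ)
    (hvol₁ : volume E₁ = ENNReal.ofReal ℓ) (hvol₂ : volume E₂ = ENNReal.ofReal ℓ)
    (hside : ∀ s ∈ E₁, ε * (s - c) ≤ 0) (hbdd : ∀ s ∈ E₂, ε * (s - c) ≤ M) (hlam : 0 ≤ lam)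
    (hΛ₁ : ∀ s ∈ E₁, ∏ i, ‖(s : ℂ) - z i‖ ≤ lam ^ d)
    (hΛ₂ : ∀ s ∈ E₂, ∏ i, ‖(s : ℂ) - z i‖ ≤ lam ^ d) :
    ∫⁻ t in E₂, ENNReal.ofReal (ε * (t - c)) ≤ ENNReal.ofReal (Real.exp 22 * lam) := by
  have hfin : ∫⁻ t in E₂, ENNReal.ofReal (ε * (t - c)) ≠ ⊤ := by
    refine ne_top_of_le_ne_top (b := ENNReal.ofReal M * ENNReal.ofReal ℓ)
      (ENNReal.mul_ne_top ENNReal.ofReal_ne_top ENNReal.ofReal_ne_top) ?_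
    calc _ ≤ ∫⁻ t in E₂, ENNReal.ofReal M :=
          setLIntegral_mono' hE₂ fun s hs => ENNReal.ofReal_le_ofReal (hbdd s hs)
      _ = _ := by simp [hvol₂]
  rw [← ENNReal.ofReal_toReal hfin]
  refine ENNReal.ofReal_le_ofReal ?_
  set J := (∫⁻ t in E₂, ENNReal.ofReal (ε * (t - c))).toReal with hJdef
  rcases (show 0 ≤ J from ENNReal.toReal_nonneg).eq_or_lt with h0 | hJ
  · rw [← h0]; positivity
  have := pow_card_le_of_prod_norm_le z hE₁ hE₂ hε hℓ hvol₁ hvol₂ hside hJ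
    (ENNReal.ofReal_toReal hfin).symm hΛ₁ hΛ₂
  rw [Fintype.card_fin] at this
  refine (pow_le_pow_iff_left₀ hJ.le (by positivity) (show 2 * d ≠ 0 by omega)).1 (this.trans ?_)
  rw [mul_pow, ← Real.exp_nat_mul, mul_comm d 2 |> fun _ => (pow_mul' lam 2 d).symm]
  rw [mul_comm (22 : ℝ)]

lemma exists_volume_inter_Iic_eq {E : Set ℝ} {M : ℝ} (hM : 0 ≤ M) (hEM : E ⊆ Set.Icc (-M) M) :
    ∃ c, (volume (E ∩ Set.Iic c)).toReal = (volume E).toReal / 2 := by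
  have hfin : volume E ≠ ⊤ := measure_ne_top_of_subset hEM (by simp)
  have hfin' : ∀ x, volume (E ∩ Set.Iic x) ≠ ⊤ := fun x =>
    measure_ne_top_of_subset Set.inter_subset_left hfin
  have hlip : LipschitzWith 1 fun x => (volume (E ∩ Set.Iic x)).toReal := by
    refine LipschitzWith.of_le_add fun x y => ?_
    rw [Real.dist_eq]
    have hsub : E ∩ Set.Iic x ⊆ (E ∩ Set.Iic y) ∪ Set.Ioc y x := by
      rintro t ⟨ht, htx⟩
      rcases le_or_gt t y with h | h
      · exact Or.inl ⟨ht, h⟩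
      · exact Or.inr ⟨h, htx⟩
    have h1 := (measure_mono hsub).trans (measure_union_le (μ := volume) _ _)
    rw [Real.volume_Ioc] at h1
    have h2 := ENNReal.toReal_mono (ENNReal.add_ne_top.2 ⟨hfin' y, ENNReal.ofReal_ne_top⟩) h1
    rw [ENNReal.toReal_add (hfin' y) ENNReal.ofReal_ne_top] at h2
    have h3 : (ENNReal.ofReal (x - y)).toReal ≤ |x - y| := by
      rw [ENNReal.toReal_ofReal']; exact max_le (le_abs_self _) (abs_nonneg _)
    linarith
  have hIVT := intermediate_value_Icc (show -M - 1 ≤ M by linarith) hlip.continuous.continuousOn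
  have h0 : (volume (E ∩ Set.Iic (-M - 1))).toReal = 0 := by
    have : E ∩ Set.Iic (-M - 1) = ∅ := by
      ext t
      simp only [Set.mem_inter_iff, Set.mem_Iic, Set.mem_empty_iff_false, iff_false, not_and]
      intro ht
      have := (hEM ht).1
      linarith
    rw [this]; simp
  have h1 : E ∩ Set.Iic M = E := Set.inter_eq_left.2 fun t ht => (hEM ht).2
  have hmem : (volume E).toReal / 2 ∈ Set.Icc (volume (E ∩ Set.Iic (-M - 1))).toReal
      (volume (E ∩ Set.Iic M)).toReal := by
    rw [h0, h1]
    have := ENNReal.toReal_nonneg (a := volume E)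
    exact ⟨by linarith, by linarith⟩
  obtain ⟨c, -, hc⟩ := hIVT hmem
  exact ⟨c, hc⟩

/-- A set on which a monic complex polynomial of degree `2 * d` is at most `lam ^ d` has mean
pairwise distance at most a multiple of `lam / volume E`. -/
lemma lintegral_abs_sub_le_of_prod_norm_le {d : ℕ} (hd : 1 ≤ d) (z : Fin (2 * d) → ℂ)
    {E : Set ℝ} (hE : MeasurableSet E) {M lam : ℝ} (hM : 0 ≤ M) (hEM : E ⊆ Set.Icc (-M) M)
    (hlam : 0 ≤ lam) (hΛ : ∀ s ∈ E, ∏ i, ‖(s : ℂ) - z i‖ ≤ lam ^ d) :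
    ∫⁻ s in E, ∫⁻ t in E, ENNReal.ofReal |s - t| ≤
      ENNReal.ofReal (4 * Real.exp 22 * lam) * volume E := by
  have hfin : volume E ≠ ⊤ := measure_ne_top_of_subset hEM (by simp)
  rcases eq_or_ne (volume E) 0 with h0 | h0
  · rw [Measure.restrict_eq_zero.2 h0]; simp
  have hEpos : 0 < (volume E).toReal := ENNReal.toReal_pos h0 hfin
  obtain ⟨c, hc⟩ := exists_volume_inter_Iic_eq hM hEM
  set ℓ := (volume E).toReal / 2 with hℓ
  have hℓ0 : 0 < ℓ := by positivity
  set E₁ := E ∩ Set.Iic c with hE₁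
  set E₂ := E \ Set.Iic c with hE₂
  have hm₁ : MeasurableSet E₁ := hE.inter measurableSet_Iic
  have hm₂ : MeasurableSet E₂ := hE.diff measurableSet_Iic
  have hadd : volume E₁ + volume E₂ = volume E := measure_inter_add_sdiff E measurableSet_Iic
  have hf₁ : volume E₁ ≠ ⊤ := measure_ne_top_of_subset Set.inter_subset_left hfin
  have hf₂ : volume E₂ ≠ ⊤ := measure_ne_top_of_subset Set.sdiff_subset hfin
  have hv₁ : volume E₁ = ENNReal.ofReal ℓ := by
    rw [← hc, ENNReal.ofReal_toReal hf₁]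
  have hv₂ : volume E₂ = ENNReal.ofReal ℓ := by
    rw [← ENNReal.ofReal_toReal hf₂]
    congr 1
    have := congrArg ENNReal.toReal hadd
    rw [ENNReal.toReal_add hf₁ hf₂, hc] at this
    linarith
  have hJ₂ := lintegral_sub_le_of_prod_norm_le hd z hm₁ hm₂ (ε := 1) (c := c) (M := M - c)
    (Or.inl rfl) hℓ0 hv₁ hv₂ (fun s hs => by have := hs.2; simp only [Set.mem_Iic] at this; linarith)
    (fun s hs => by have := (hEM hs.1).2; linarith) hlam (fun s hs => hΛ s hs.1)
    (fun s hs => hΛ s hs.1)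
  have hJ₁ := lintegral_sub_le_of_prod_norm_le hd z hm₂ hm₁ (ε := -1) (c := c) (M := M + c)
    (Or.inr rfl) hℓ0 hv₂ hv₁
    (fun s hs => by have := hs.2; simp only [Set.mem_Iic, not_le] at this; linarith)
    (fun s hs => by have := (hEM hs.1).1; linarith) hlam (fun s hs => hΛ s hs.1)
    (fun s hs => hΛ s hs.1)
  have hT : ∫⁻ t in E, ENNReal.ofReal |t - c| ≤ ENNReal.ofReal (2 * Real.exp 22 * lam) := by
    rw [← lintegral_inter_add_sdiff _ E measurableSet_Iic (B := Set.Iic c)]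
    calc _ = (∫⁻ t in E₁, ENNReal.ofReal (-1 * (t - c))) +
          ∫⁻ t in E₂, ENNReal.ofReal (1 * (t - c)) := by
          congr 1
          · refine setLIntegral_congr_fun hm₁ fun t ht => ?_
            have h := ht.2
            simp only [Set.mem_Iic] at h
            rw [abs_of_nonpos (by linarith)]; simp
          · refine setLIntegral_congr_fun hm₂ fun t ht => ?_
            have h := ht.2
            simp only [Set.mem_Iic, not_le] at h
            rw [abs_of_pos (by linarith)]; simp
      _ ≤ _ := add_le_add hJ₁ hJ₂
      _ = _ := by
        rw [← ENNReal.ofReal_add (by positivity) (by positivity)]; congr 1; ring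
  calc _ ≤ ∫⁻ s in E, ∫⁻ t in E, (ENNReal.ofReal |s - c| + ENNReal.ofReal |t - c|) := by
        refine lintegral_mono fun s => lintegral_mono fun t => ?_
        rw [← ENNReal.ofReal_add (abs_nonneg _) (abs_nonneg _)]
        refine ENNReal.ofReal_le_ofReal ?_
        rw [abs_sub_comm t c]
        exact abs_sub_le s c t
    _ = 2 * (∫⁻ t in E, ENNReal.ofReal |t - c|) * volume E := by
      have : ∀ s, ∫⁻ t in E, (ENNReal.ofReal |s - c| + ENNReal.ofReal |t - c|) =
          ENNReal.ofReal |s - c| * volume E + ∫⁻ t in E, ENNReal.ofReal |t - c| := fun s => by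
        rw [lintegral_add_left (by fun_prop)]; simp
      simp_rw [this]
      rw [lintegral_add_right _ (by fun_prop), lintegral_mul_const _ (by fun_prop)]
      simp
      ring
    _ ≤ 2 * ENNReal.ofReal (2 * Real.exp 22 * lam) * volume E := by gcongr
    _ = _ := by
      rw [show (2 : ENNReal) = ENNReal.ofReal 2 by simp, ← ENNReal.ofReal_mul (by norm_num)]
      congr 2; ring

lemma measurePreserving_rotated_coords {e : ℂ} (he : ‖e‖ = 1) :
    MeasurePreserving (fun p : ℝ × ℝ => e * ((p.1 : ℂ) + (p.2 : ℂ) * Complex.I)) := by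
  have h1 : MeasurePreserving (rotation (⟨e, by simp [Submonoid.unitSphere, he]⟩ : Circle)) :=
    LinearIsometryEquiv.measurePreserving _
  have h2 := Complex.volume_preserving_equiv_real_prod.symm
  have h3 := h1.comp h2
  convert h3 using 1
  funext p
  simp only [Function.comp]
  congr 1
  apply Complex.ext <;> simp

lemma lintegral_ray_le {d : ℕ} (hd : 1 ≤ d) {E : Set ℂ} (hE : MeasurableSet E) {R lam : ℝ}
    (hR : 0 ≤ R) (hER : ∀ w ∈ E, ‖w‖ ≤ R) (hlam : 0 ≤ lam) {e : ℂ} (he : ‖e‖ = 1)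
    (H : ∀ y : ℝ, ∃ z : Fin (2 * d) → ℂ, ∀ x : ℝ, e * ((x : ℂ) + (y : ℂ) * Complex.I) ∈ E →
      ∏ i, ‖(x : ℂ) - z i‖ ≤ lam ^ d) :
    ∫⁻ w in E, ∫⁻ r in Set.Ioi (0 : ℝ), ENNReal.ofReal r * E.indicator 1 (w + r * e) ≤
      ENNReal.ofReal (4 * Real.exp 22 * lam) * volume E := by
  set T := fun p : ℝ × ℝ => e * ((p.1 : ℂ) + (p.2 : ℂ) * Complex.I) with hT
  have hTmp : MeasurePreserving T := measurePreserving_rotated_coords he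
  have hTm : Measurable T := hTmp.measurable
  set S : ℝ → Set ℝ := fun y => {x | T (x, y) ∈ E} with hS
  have hSm : ∀ y, MeasurableSet (S y) := fun y => by
    have : Measurable fun x : ℝ => T (x, y) := hTm.comp (by fun_prop)
    exact this hE
  have hind : Measurable (E.indicator (1 : ℂ → ENNReal)) := measurable_one.indicator hE
  have hF : Measurable fun w : ℂ => ∫⁻ r in Set.Ioi (0 : ℝ),
      ENNReal.ofReal r * E.indicator (1 : ℂ → ENNReal) (w + r * e) := by
    refine Measurable.lintegral_prod_right'
      (f := fun q : ℂ × ℝ => ENNReal.ofReal q.2 * E.indicator (1 : ℂ → ENNReal) (q.1 + q.2 * e)) ?_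
    refine Measurable.mul (by fun_prop) (hind.comp ?_)
    fun_prop
  have hvol : ∫⁻ y, volume (S y) = volume E := by
    rw [← hTmp.measure_preimage hE.nullMeasurableSet, Measure.volume_eq_prod,
      Measure.prod_apply_symm (hTm hE)]
    rfl
  calc _ = ∫⁻ p, E.indicator (fun w => ∫⁻ r in Set.Ioi (0 : ℝ),
        ENNReal.ofReal r * E.indicator 1 (w + r * e)) (T p) := by
        rw [hTmp.lintegral_comp (hF.indicator hE), lintegral_indicator hE]
    _ = ∫⁻ y, ∫⁻ x in S y, ∫⁻ r in Set.Ioi (0 : ℝ),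
        ENNReal.ofReal r * E.indicator 1 (T (x, y) + r * e) := by
      have hcomp : Measurable fun p => E.indicator (fun w => ∫⁻ r in Set.Ioi (0 : ℝ),
          ENNReal.ofReal r * E.indicator (1 : ℂ → ENNReal) (w + r * e)) (T p) :=
        (hF.indicator hE).comp hTm
      rw [Measure.volume_eq_prod, lintegral_prod_symm' _ hcomp]
      refine lintegral_congr fun y => ?_
      rw [← lintegral_indicator (hSm y)]
      rfl
    _ ≤ ∫⁻ y, ENNReal.ofReal (4 * Real.exp 22 * lam) * volume (S y) := by
      refine lintegral_mono fun y => ?_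
      obtain ⟨z, hz⟩ := H y
      refine le_trans ?_ (lintegral_abs_sub_le_of_prod_norm_le hd z (hSm y) hR ?_ hlam hz)
      · refine lintegral_mono fun x => ?_
        have hsub : ∀ r : ℝ, T (x, y) + r * e = T (x + r, y) := fun r => by
          simp only [hT]; push_cast; ring
        simp_rw [hsub]
        rw [← lintegral_indicator measurableSet_Ioi, ← lintegral_indicator (hSm y)]
        conv_rhs => rw [← lintegral_add_left_eq_self _ x]
        refine lintegral_mono fun r => ?_
        by_cases hr : r ∈ Set.Ioi (0 : ℝ)
        · rw [Set.indicator_of_mem hr]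
          by_cases hxr : T (x + r, y) ∈ E
          · rw [Set.indicator_of_mem hxr, Set.indicator_of_mem (show x + r ∈ S y from hxr)]
            simp only [Pi.one_apply, mul_one]
            rw [show x - (x + r) = -r by ring, abs_neg, abs_of_pos hr]
          · rw [Set.indicator_of_notMem hxr]; simp
        · rw [Set.indicator_of_notMem hr]; exact zero_le
      · intro x hx
        have h1 := hER _ hx
        have h2 : |x| ≤ ‖T (x, y)‖ := by
          simp only [hT, norm_mul, he, one_mul]
          have := Complex.abs_re_le_norm ((x : ℂ) + (y : ℂ) * Complex.I)
          simpa using this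
        exact abs_le.1 (h2.trans h1)
    _ = _ := by
      rw [lintegral_const_mul', hvol]
      exact ENNReal.ofReal_ne_top

/-- A planar set whose intersection with every line lies in a sublevel set of a monic polynomial
of degree `2 * d` has small area. -/
lemma volume_le_of_forall_line {d : ℕ} (hd : 1 ≤ d) {E : Set ℂ} (hE : MeasurableSet E)
    {R lam : ℝ} (hR : 0 ≤ R) (hER : ∀ w ∈ E, ‖w‖ ≤ R) (hlam : 0 ≤ lam)
    (H : ∀ e : ℂ, ‖e‖ = 1 → ∀ y : ℝ, ∃ z : Fin (2 * d) → ℂ, ∀ x : ℝ,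
      e * ((x : ℂ) + (y : ℂ) * Complex.I) ∈ E → ∏ i, ‖(x : ℂ) - z i‖ ≤ lam ^ d) :
    volume E ≤ ENNReal.ofReal (8 * Real.pi * Real.exp 22 * lam) := by
  have hfin : volume E ≠ ⊤ := by
    refine measure_ne_top_of_subset (s := Metric.closedBall (0 : ℂ) R) ?_
      (measure_closedBall_lt_top (μ := volume)).ne
    intro w hw
    simpa using hER w hw
  have hind : Measurable (E.indicator (1 : ℂ → ENNReal)) := measurable_one.indicator hE
  have hpm : Measurable fun q : ℝ × ℝ => Complex.polarCoord.symm q := by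
    have : (fun q : ℝ × ℝ => Complex.polarCoord.symm q) =
        fun q : ℝ × ℝ => (q.1 : ℂ) * (Real.cos q.2 + Real.sin q.2 * Complex.I) := by
      funext q; simp [Complex.polarCoord_symm_apply]
    rw [this]; fun_prop
  have hmain : volume E * volume E ≤
      ENNReal.ofReal (8 * Real.pi * Real.exp 22 * lam) * volume E := by
    have h1 : ∀ w : ℂ, volume E = ∫⁻ p in Set.Ioi (0 : ℝ) ×ˢ Set.Ioo (-Real.pi) Real.pi,
        ENNReal.ofReal p.1 * E.indicator 1 (w + Complex.polarCoord.symm p) := by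
      intro w
      have := Complex.lintegral_comp_polarCoord_symm
        (fun v => E.indicator (1 : ℂ → ENNReal) (w + v))
      rw [lintegral_add_left_eq_self (μ := volume) (fun v => E.indicator (1 : ℂ → ENNReal) v) w,
        lintegral_indicator_one hE] at this
      rw [← this]
      rfl
    have hmeas3 : Measurable fun q : ℂ × (ℝ × ℝ) =>
        ENNReal.ofReal q.2.1 * E.indicator (1 : ℂ → ENNReal)
          (q.1 + Complex.polarCoord.symm q.2) :=
      Measurable.mul (by fun_prop) (hind.comp (measurable_fst.add (hpm.comp measurable_snd)))
    calc volume E * volume E = ∫⁻ w in E, volume E := by simp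
      _ = ∫⁻ w in E, ∫⁻ p in Set.Ioi (0 : ℝ) ×ˢ Set.Ioo (-Real.pi) Real.pi,
          ENNReal.ofReal p.1 * E.indicator 1 (w + Complex.polarCoord.symm p) :=
        lintegral_congr fun w => h1 w
      _ = ∫⁻ w in E, ∫⁻ α in Set.Ioo (-Real.pi) Real.pi, ∫⁻ r in Set.Ioi (0 : ℝ),
          ENNReal.ofReal r * E.indicator 1 (w + Complex.polarCoord.symm (r, α)) := by
        refine lintegral_congr fun w => ?_
        rw [Measure.volume_eq_prod, ← Measure.prod_restrict, lintegral_prod_symm']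
        exact hmeas3.comp (measurable_const.prodMk measurable_id)
      _ = ∫⁻ α in Set.Ioo (-Real.pi) Real.pi, ∫⁻ w in E, ∫⁻ r in Set.Ioi (0 : ℝ),
          ENNReal.ofReal r * E.indicator 1 (w + Complex.polarCoord.symm (r, α)) := by
        refine lintegral_lintegral_swap ?_
        refine Measurable.aemeasurable ?_
        refine Measurable.lintegral_prod_right'
          (f := fun q : (ℂ × ℝ) × ℝ => ENNReal.ofReal q.2 * E.indicator (1 : ℂ → ENNReal)
            (q.1.1 + Complex.polarCoord.symm (q.2, q.1.2))) ?_
        exact hmeas3.comp (g := fun q : ℂ × (ℝ × ℝ) =>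
        ENNReal.ofReal q.2.1 * E.indicator (1 : ℂ → ENNReal)
          (q.1 + Complex.polarCoord.symm q.2))
          (f := fun q : (ℂ × ℝ) × ℝ => (q.1.1, (q.2, q.1.2))) (by fun_prop)
      _ ≤ ∫⁻ α in Set.Ioo (-Real.pi) Real.pi,
          ENNReal.ofReal (4 * Real.exp 22 * lam) * volume E := by
        refine lintegral_mono fun α => ?_
        have he : ‖(Real.cos α + Real.sin α * Complex.I : ℂ)‖ = 1 := by
          have := Complex.norm_exp_ofReal_mul_I α
          rwa [Complex.exp_mul_I, ← Complex.ofReal_cos, ← Complex.ofReal_sin] at this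
        have := lintegral_ray_le hd hE hR hER hlam he (H _ he)
        simpa only [Complex.polarCoord_symm_apply] using this
      _ = _ := by
        rw [lintegral_const, Measure.restrict_apply_univ, Real.volume_Ioo, mul_comm, ← mul_assoc,
          ← ENNReal.ofReal_mul (by linarith [Real.pi_pos])]
        congr 2; ring
  rcases eq_or_ne (volume E) 0 with h0 | h0
  · rw [h0]; exact zero_le
  · exact (ENNReal.mul_le_mul_iff_left h0 hfin).1 hmain

/-- The multilinear polynomial with coefficients `c`. -/
noncomputable def multilin {n : ℕ} (c : Finset (Fin n) → ℝ) (x : Fin n → ℝ) : ℝ :=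
  ∑ S : Finset (Fin n), c S * ∏ i ∈ S, x i

lemma continuous_multilin {n : ℕ} (c : Finset (Fin n) → ℝ) : Continuous (multilin c) := by
  unfold multilin; fun_prop

@[fun_prop]
lemma measurable_multilin {n : ℕ} (c : Finset (Fin n) → ℝ) : Measurable (multilin c) :=
  (continuous_multilin c).measurable

/-- The combination of three vectors with coefficients given by the point of the unit sphere that
projects stereographically to `w`. -/
noncomputable def sphComb {n : ℕ} (w : ℂ) (X Y Z : Fin n → ℝ) : Fin n → ℝ := fun i =>
  ((Complex.normSq w - 1) * X i + 2 * w.re * Y i + 2 * w.im * Z i) / (1 + Complex.normSq w)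

lemma Polynomial.exists_eval_eq_mul_prod {m : ℕ} {P : Polynomial ℂ} {a : ℂ}
    (hP : P.natDegree ≤ m) (ha : P.coeff m = a) (ha0 : a ≠ 0) :
    ∃ z : Fin m → ℂ, ∀ x, P.eval x = a * ∏ i, (x - z i) := by
  have hdeg : P.natDegree = m :=
    le_antisymm hP (Polynomial.le_natDegree_of_ne_zero (by rwa [ha]))
  have hlead : P.leadingCoeff = a := by rw [Polynomial.leadingCoeff, hdeg, ha]
  have hsplit := IsAlgClosed.splits P
  have hcard : P.roots.toList.length = m := by
    rw [Multiset.length_toList, ← hdeg]; exact hsplit.natDegree_eq_card_roots.symm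
  refine ⟨fun i => P.roots.toList.get (i.cast hcard.symm), fun x => ?_⟩
  have h := hsplit.eval_eq_prod_roots x
  rw [h, hlead]
  congr 1
  conv_lhs => rw [← Multiset.coe_toList P.roots]
  rw [Multiset.map_coe, Multiset.prod_coe, ← List.prod_ofFn]
  congr 1
  subst hcard
  apply List.ext_getElem <;> simp

section
open Polynomial

lemma exists_roots_multilin_line {n d : ℕ} {c : Finset (Fin n) → ℝ}
    (hc : ∀ S : Finset (Fin n), d < S.card → c S = 0) (X Y Z : Fin n → ℝ)
    (hX : multilin c X ≠ 0) {e : ℂ} (he : ‖e‖ = 1) (y : ℝ) :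
    ∃ z : Fin (2 * d) → ℂ, ∀ x : ℝ, ∀ w : ℂ, w = e * ((x : ℂ) + (y : ℂ) * Complex.I) →
      (1 + Complex.normSq w) ^ d * |multilin c (sphComb w X Y Z)| =
        |multilin c X| * ∏ i, ‖(x : ℂ) - z i‖ := by
  set D : ℂ[X] := Polynomial.X ^ 2 + C ((1 + y ^ 2 : ℝ) : ℂ) with hD
  set p : Fin n → ℂ[X] := fun i => C (X i : ℂ) * Polynomial.X ^ 2 +
    C ((2 * e.re * Y i + 2 * e.im * Z i : ℝ) : ℂ) * Polynomial.X +
    C (((y ^ 2 - 1) * X i - 2 * e.im * y * Y i + 2 * e.re * y * Z i : ℝ) : ℂ) with hp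
  set P : ℂ[X] := ∑ S : Finset (Fin n), C (c S : ℂ) * (D ^ (d - S.card) * ∏ i ∈ S, p i) with hPdef
  have hDdeg : D.natDegree ≤ 2 := by rw [hD]; compute_degree
  have hDco : D.coeff 2 = 1 := by rw [hD, coeff_add, coeff_X_pow, coeff_C]; simp
  have hpdeg : ∀ i, (p i).natDegree ≤ 2 := fun i => by simp only [hp]; compute_degree
  have hpco : ∀ i, (p i).coeff 2 = X i := fun i => by
    simp only [hp, coeff_add, coeff_C_mul, coeff_X_pow, coeff_X, coeff_C]; simp
  have hterm : ∀ S : Finset (Fin n), S.card ≤ d →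
      (D ^ (d - S.card) * ∏ i ∈ S, p i).natDegree ≤ 2 * d ∧
      (D ^ (d - S.card) * ∏ i ∈ S, p i).coeff (2 * d) = ((∏ i ∈ S, X i : ℝ) : ℂ) := by
    intro S hS
    have h1 : (D ^ (d - S.card)).natDegree ≤ (d - S.card) * 2 := natDegree_pow_le_of_le _ hDdeg
    have h2 : (∏ i ∈ S, p i).natDegree ≤ S.card * 2 := by
      refine (natDegree_prod_le _ _).trans ?_
      refine (Finset.sum_le_card_nsmul _ _ 2 fun i _ => hpdeg i).trans (by simp)
    have hsum : 2 * d = (d - S.card) * 2 + S.card * 2 := by omega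
    refine ⟨(natDegree_mul_le_of_le h1 h2).trans hsum.ge, ?_⟩
    rw [hsum, coeff_mul_add_eq_of_natDegree_le h1 h2, coeff_pow_of_natDegree_le hDdeg, hDco,
      coeff_prod_of_natDegree_le _ _ 2 fun i _ => hpdeg i]
    simp [hpco]
  have hPdeg : P.natDegree ≤ 2 * d := by
    refine natDegree_sum_le_of_forall_le _ _ fun S _ => ?_
    rcases le_or_gt S.card d with h | h
    · exact (natDegree_C_mul_le _ _).trans (hterm S h).1
    · rw [hc S h]; simp
  have hPco : P.coeff (2 * d) = (multilin c X : ℂ) := by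
    rw [hPdef, finsetSum_coeff, multilin, Complex.ofReal_sum]
    refine Finset.sum_congr rfl fun S _ => ?_
    rw [coeff_C_mul]
    rcases le_or_gt S.card d with h | h
    · rw [(hterm S h).2]; push_cast; ring
    · rw [hc S h]; simp
  obtain ⟨z, hz⟩ := Polynomial.exists_eval_eq_mul_prod hPdeg hPco (by exact_mod_cast hX)
  refine ⟨z, fun x w hw => ?_⟩
  have hre : w.re = e.re * x - e.im * y := by rw [hw]; simp
  have him : w.im = e.re * y + e.im * x := by rw [hw]; simp
  have hnsq : Complex.normSq w = x ^ 2 + y ^ 2 := by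
    rw [hw, Complex.normSq_mul, Complex.normSq_eq_norm_sq e, he, Complex.normSq_add_mul_I]; ring
  have hpos : 0 < 1 + Complex.normSq w := by have := Complex.normSq_nonneg w; linarith
  have hDe : D.eval (x : ℂ) = ((1 + Complex.normSq w : ℝ) : ℂ) := by
    rw [hnsq, hD]; simp; ring
  have hpe : ∀ i, (p i).eval (x : ℂ) =
      (((1 + Complex.normSq w) * sphComb w X Y Z i : ℝ) : ℂ) := fun i => by
    rw [sphComb, mul_div_cancel₀ _ hpos.ne', hnsq, hre, him]
    simp [hp]; ring
  have hPe : P.eval (x : ℂ) = (((1 + Complex.normSq w) ^ d * multilin c (sphComb w X Y Z) : ℝ) : ℂ) := by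
    rw [hPdef, eval_finsetSum, multilin, Finset.mul_sum, Complex.ofReal_sum]
    refine Finset.sum_congr rfl fun S _ => ?_
    rw [eval_C_mul, eval_mul, eval_pow, eval_prod, hDe]
    simp_rw [hpe]
    rcases le_or_gt S.card d with h | h
    · rw [← Complex.ofReal_prod, Finset.prod_mul_distrib, Finset.prod_const]
      have : (1 + Complex.normSq w) ^ d =
          (1 + Complex.normSq w) ^ (d - S.card) * (1 + Complex.normSq w) ^ S.card := by
        rw [← pow_add]; congr 1; omega
      rw [this]; push_cast; ring
    · rw [hc S h]; simp
  have h := congrArg norm (hz (x : ℂ))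
  rw [hPe, norm_mul, norm_prod, Complex.norm_real, Complex.norm_real, Real.norm_eq_abs,
    Real.norm_eq_abs, abs_mul, abs_of_pos (pow_pos hpos d)] at h
  exact h

end

lemma measurable_sphComb {n : ℕ} (X Y Z : Fin n → ℝ) : Measurable fun w => sphComb w X Y Z := by
  unfold sphComb
  have : Measurable Complex.normSq := Complex.continuous_normSq.measurable
  fun_prop

/-- On most of the sphere spanned by `X, Y, Z` the polynomial is not much smaller than at `X`. -/
lemma volume_sphComb_small_le {n d : ℕ} (hd : 1 ≤ d) {c : Finset (Fin n) → ℝ}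
    (hc : ∀ S : Finset (Fin n), d < S.card → c S = 0) (X Y Z : Fin n → ℝ)
    (hX : multilin c X ≠ 0) {r : ℝ} (hr : 0 ≤ r) :
    volume {w : ℂ | ‖w‖ ≤ 5 ∧ |multilin c (sphComb w X Y Z)| ≤ r ^ d} ≤
      ENNReal.ofReal (208 * Real.pi * Real.exp 22 * r / |multilin c X| ^ (1 / d : ℝ)) := by
  have hX0 : 0 < |multilin c X| := abs_pos.2 hX
  have hd0 : (d : ℝ) ≠ 0 := by positivity
  set ρ := |multilin c X| ^ (1 / d : ℝ) with hρ
  have hρ0 : 0 < ρ := Real.rpow_pos_of_pos hX0 _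
  have hρd : ρ ^ d = |multilin c X| := by
    rw [hρ, ← Real.rpow_natCast, ← Real.rpow_mul hX0.le, one_div_mul_cancel hd0, Real.rpow_one]
  have hmeas : MeasurableSet {w : ℂ | ‖w‖ ≤ 5 ∧ |multilin c (sphComb w X Y Z)| ≤ r ^ d} := by
    have h1 := (measurable_multilin c).comp (measurable_sphComb X Y Z)
    exact (measurableSet_le measurable_norm measurable_const).inter
      (measurableSet_le (continuous_abs.measurable.comp h1) measurable_const)
  have := volume_le_of_forall_line hd hmeas (R := 5) (lam := 26 * r / ρ) (by norm_num)
    (fun w hw => hw.1) (by positivity) ?_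
  · refine this.trans (le_of_eq ?_); congr 1; ring
  intro e he y
  obtain ⟨z, hz⟩ := exists_roots_multilin_line hc X Y Z hX he y
  refine ⟨z, fun x hx => ?_⟩
  have h := hz x _ rfl
  set w := e * ((x : ℂ) + (y : ℂ) * Complex.I)
  have hn : 1 + Complex.normSq w ≤ 26 := by
    rw [Complex.normSq_eq_norm_sq]; nlinarith [hx.1, norm_nonneg w]
  have hn0 : 0 ≤ 1 + Complex.normSq w := by have := Complex.normSq_nonneg w; linarith
  have hle : |multilin c X| * ∏ i, ‖(x : ℂ) - z i‖ ≤ 26 ^ d * r ^ d := by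
    rw [← h]
    exact mul_le_mul (pow_le_pow_left₀ hn0 hn d) hx.2 (abs_nonneg _) (by positivity)
  rw [div_pow, mul_pow, hρd, le_div_iff₀ hX0, mul_comm]
  exact hle

/-- Log-polar coordinates in the plane around the point `1`, at base radius `√2`. -/
noncomputable def logPolar (p : ℝ × ℝ) : ℂ :=
  1 + (√2 * Real.exp p.1 : ℝ) * (Real.cos p.2 + Real.sin p.2 * Complex.I)

/-- Lebesgue measure on the rectangle `[-1, 1] × (-π, π)` of log-polar coordinates. -/
noncomputable def logPolarMeasure : Measure (ℝ × ℝ) :=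
  (volume.restrict (Set.Icc (-1) 1)).prod (volume.restrict (Set.Ioo (-Real.pi) Real.pi))

instance : IsFiniteMeasure logPolarMeasure := by unfold logPolarMeasure; infer_instance

lemma logPolarMeasure_univ : logPolarMeasure Set.univ = ENNReal.ofReal (4 * Real.pi) := by
  rw [logPolarMeasure, Measure.prod_apply MeasurableSet.univ]
  simp only [Set.preimage_univ, Measure.restrict_apply_univ, Real.volume_Ioo, lintegral_const,
    Real.volume_Icc]
  rw [← ENNReal.ofReal_mul (by linarith [Real.pi_pos])]
  congr 1; ring

lemma measurable_logPolar : Measurable logPolar := by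
  unfold logPolar; fun_prop

lemma norm_logPolar_le {p : ℝ × ℝ} (hp : p.1 ≤ 1) : ‖logPolar p‖ ≤ 5 := by
  have h1 : ‖(Real.cos p.2 + Real.sin p.2 * Complex.I : ℂ)‖ = 1 := by
    have := Complex.norm_exp_ofReal_mul_I p.2
    rwa [Complex.exp_mul_I, ← Complex.ofReal_cos, ← Complex.ofReal_sin] at this
  have h2 : √2 ≤ 1.4143 := Real.sqrt_le_iff.2 ⟨by norm_num, by norm_num⟩
  have h3 : Real.exp p.1 ≤ 2.7183 := (Real.exp_le_exp.2 hp).trans (by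
    have := Real.exp_one_lt_d9; linarith)
  calc ‖logPolar p‖ ≤ ‖(1 : ℂ)‖ + ‖((√2 * Real.exp p.1 : ℝ) : ℂ) *
        (Real.cos p.2 + Real.sin p.2 * Complex.I)‖ := norm_add_le _ _
    _ = 1 + √2 * Real.exp p.1 := by
      rw [norm_mul, h1, Complex.norm_real, Real.norm_of_nonneg (by positivity)]; simp
    _ ≤ 1 + 1.4143 * 2.7183 := by gcongr
    _ ≤ 5 := by norm_num

lemma sphComb_logPolar {n : ℕ} (p : ℝ × ℝ) (X Y Z : Fin n → ℝ) (i : Fin n) :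
    sphComb (logPolar p) X Y Z i =
      ((√2 * Real.cos p.2 + Real.exp p.1) * X i + (√2 * Real.cos p.2 + Real.exp (-p.1)) * Y i +
        √2 * Real.sin p.2 * Z i) / (Real.exp p.1 + Real.exp (-p.1) + √2 * Real.cos p.2) := by
  have hre : (logPolar p).re = 1 + √2 * Real.exp p.1 * Real.cos p.2 := by
    simp [logPolar, -Complex.ofReal_exp, -Complex.ofReal_cos, -Complex.ofReal_sin]
  have him : (logPolar p).im = √2 * Real.exp p.1 * Real.sin p.2 := by
    simp [logPolar, -Complex.ofReal_exp, -Complex.ofReal_cos, -Complex.ofReal_sin]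
  have h2 : √2 ^ 2 = 2 := Real.sq_sqrt (by norm_num)
  have hcs := Real.sin_sq_add_cos_sq p.2
  have hE := Real.exp_pos p.1
  have hEn : Real.exp (-p.1) * Real.exp p.1 = 1 := by rw [← Real.exp_add]; simp
  have hnsq : Complex.normSq (logPolar p) =
      1 + 2 * √2 * Real.exp p.1 * Real.cos p.2 + 2 * Real.exp p.1 ^ 2 := by
    rw [Complex.normSq_apply, hre, him]
    linear_combination (Real.exp p.1) ^ 2 * √2 ^ 2 * hcs + Real.exp p.1 ^ 2 * h2
  rw [sphComb, hnsq, hre, him, ← mul_div_mul_left _ (Real.exp p.1 + Real.exp (-p.1) + √2 * Real.cos p.2)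
    (show (2 * Real.exp p.1) ≠ 0 by positivity)]
  congr 1
  · linear_combination (-2 * Y i) * hEn
  · linear_combination (-2) * hEn

lemma sphComb_logPolar_neg {n : ℕ} (p : ℝ × ℝ) (X Y Z : Fin n → ℝ) :
    sphComb (logPolar (-p.1, p.2)) X Y Z = sphComb (logPolar p) Y X Z := by
  funext i
  rw [sphComb_logPolar, sphComb_logPolar]
  simp only [neg_neg]
  congr 1 <;> ring

lemma measurePreserving_neg_fst_logPolarMeasure :
    MeasurePreserving (fun p : ℝ × ℝ => (-p.1, p.2)) logPolarMeasure logPolarMeasure := by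
  unfold logPolarMeasure
  have h1 : MeasurePreserving (fun x : ℝ => -x) (volume.restrict (Set.Icc (-1) 1))
      (volume.restrict (Set.Icc (-1 : ℝ) 1)) := by
    have := (Measure.measurePreserving_neg (volume : Measure ℝ)).restrict_preimage
      (s := Set.Icc (-1 : ℝ) 1) measurableSet_Icc
    simpa using this
  exact h1.prod (MeasurePreserving.id _)

lemma logPolarMeasure_preimage_le {E : Set ℂ} (hE : MeasurableSet E) :
    logPolarMeasure (logPolar ⁻¹' E) ≤ ENNReal.ofReal (Real.exp 2 / 2) * volume E := by
  have hind : Measurable (E.indicator (1 : ℂ → ENNReal)) := measurable_one.indicator hE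
  set g : ℝ → ℝ → ENNReal := fun α r => E.indicator 1
    (1 + (r : ℂ) * (Real.cos α + Real.sin α * Complex.I)) with hg
  have hgm : Measurable fun q : ℝ × ℝ => g q.2 q.1 := hind.comp (by fun_prop)
  have hvol : volume E = ∫⁻ α in Set.Ioo (-Real.pi) Real.pi, ∫⁻ r in Set.Ioi (0 : ℝ),
      ENNReal.ofReal r * g α r := by
    have := Complex.lintegral_comp_polarCoord_symm
      (fun v => E.indicator (1 : ℂ → ENNReal) (1 + v))
    rw [lintegral_add_left_eq_self (μ := volume) (fun v => E.indicator (1 : ℂ → ENNReal) v) 1,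
      lintegral_indicator_one hE] at this
    rw [← this]
    simp only [Complex.polarCoord_symm_apply]
    change ∫⁻ p in Set.Ioi (0 : ℝ) ×ˢ Set.Ioo (-Real.pi) Real.pi, _ = _
    rw [Measure.volume_eq_prod, ← Measure.prod_restrict, lintegral_prod_symm']
    · rfl
    · exact Measurable.mul (by fun_prop) hgm
  have hs : ∀ α, ∫⁻ σ in Set.Icc (-1 : ℝ) 1, g α (√2 * Real.exp σ) ≤
      ENNReal.ofReal (Real.exp 2 / 2) * ∫⁻ r in Set.Ioi (0 : ℝ), ENNReal.ofReal r * g α r := by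
    intro α
    have hder : ∀ x ∈ Set.Icc (-1 : ℝ) 1, HasDerivWithinAt (fun σ => √2 * Real.exp σ)
        (√2 * Real.exp x) (Set.Icc (-1) 1) x := fun x _ =>
      ((Real.hasDerivAt_exp x).const_mul _).hasDerivWithinAt
    have hinj : Set.InjOn (fun σ => √2 * Real.exp σ) (Set.Icc (-1 : ℝ) 1) := by
      intro x _ y _ h
      have h2 : √2 ≠ 0 := by positivity
      exact Real.exp_injective (mul_left_cancel₀ h2 h)
    have hcv := lintegral_image_eq_lintegral_abs_deriv_mul measurableSet_Icc hder hinj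
      (fun r => ENNReal.ofReal r * g α r)
    have hsub : (fun σ => √2 * Real.exp σ) '' Set.Icc (-1 : ℝ) 1 ⊆ Set.Ioi 0 := by
      rintro _ ⟨x, _, rfl⟩
      exact mul_pos (by positivity) (Real.exp_pos x)
    refine le_trans ?_ (mul_le_mul_right (lintegral_mono_set hsub) _)
    rw [hcv, ← lintegral_const_mul' _ _ ENNReal.ofReal_ne_top]
    refine setLIntegral_mono' measurableSet_Icc fun x hx => ?_
    rw [← mul_assoc, ← mul_assoc, abs_of_nonneg (by positivity),
      ← ENNReal.ofReal_mul (by positivity), ← ENNReal.ofReal_mul (by positivity)]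
    refine le_mul_of_one_le_left zero_le (ENNReal.one_le_ofReal.2 ?_)
    have h2 : √2 * √2 = 2 := Real.mul_self_sqrt (by norm_num)
    have h3 : Real.exp 2 / 2 * (√2 * Real.exp x) * (√2 * Real.exp x) =
        Real.exp (2 + x + x) := by
      rw [Real.exp_add, Real.exp_add]
      linear_combination (Real.exp 2 / 2 * Real.exp x * Real.exp x) * h2
    rw [h3]
    exact Real.one_le_exp (by linarith [hx.1])
  rw [logPolarMeasure, Measure.prod_apply_symm (measurable_logPolar hE), hvol,
    ← lintegral_const_mul' _ _ ENNReal.ofReal_ne_top]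
  refine lintegral_mono fun α => le_trans (le_of_eq ?_) (hs α)
  have hm : MeasurableSet ((fun x : ℝ => (x, α)) ⁻¹' (logPolar ⁻¹' E)) :=
    (measurable_logPolar.comp (by fun_prop : Measurable fun x : ℝ => (x, α))) hE
  rw [← lintegral_indicator_one hm]
  rfl

lemma ae_logPolarMeasure_fst_le : ∀ᵐ p ∂logPolarMeasure, p.1 ≤ 1 := by
  rw [ae_iff, logPolarMeasure]
  have : {p : ℝ × ℝ | ¬ p.1 ≤ 1} = Set.Ioi 1 ×ˢ Set.univ := by ext p; simp
  rw [this, Measure.prod_prod, Measure.restrict_apply measurableSet_Ioi]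
  have : Set.Ioi (1 : ℝ) ∩ Set.Icc (-1) 1 = ∅ := by
    ext x; simp only [Set.mem_inter_iff, Set.mem_Ioi, Set.mem_Icc, Set.mem_empty_iff_false,
      iff_false, not_and, not_le]
    intro h1 _; exact h1
  simp [this]

/-- The constant in the small-ball estimates on spheres. -/
noncomputable def sphConst : ℝ := Real.exp 2 / 2 * (208 * Real.pi * Real.exp 22)

lemma sphConst_pos : 0 < sphConst := by
  have := Real.pi_pos
  unfold sphConst; positivity

lemma logPolarMeasure_small_le {n d : ℕ} (hd : 1 ≤ d) {c : Finset (Fin n) → ℝ}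
    (hc : ∀ S : Finset (Fin n), d < S.card → c S = 0) (X Y Z : Fin n → ℝ)
    (hX : multilin c X ≠ 0) {r : ℝ} (hr : 0 ≤ r) :
    logPolarMeasure {p | |multilin c (sphComb (logPolar p) X Y Z)| ≤ r ^ d} ≤
      ENNReal.ofReal (sphConst * r / |multilin c X| ^ (1 / d : ℝ)) := by
  set E := {w : ℂ | ‖w‖ ≤ 5 ∧ |multilin c (sphComb w X Y Z)| ≤ r ^ d} with hE
  have hmeas : MeasurableSet E := by
    have h1 := (measurable_multilin c).comp (measurable_sphComb X Y Z)
    exact (measurableSet_le measurable_norm measurable_const).inter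
      (measurableSet_le (continuous_abs.measurable.comp h1) measurable_const)
  calc _ ≤ logPolarMeasure (logPolar ⁻¹' E) := by
        refine measure_mono_ae ?_
        filter_upwards [ae_logPolarMeasure_fst_le] with p hp hpE
        exact ⟨norm_logPolar_le hp, hpE⟩
    _ ≤ _ := logPolarMeasure_preimage_le hmeas
    _ ≤ _ := mul_le_mul_right (volume_sphComb_small_le hd hc X Y Z hX hr) _
    _ = _ := by
      rw [← ENNReal.ofReal_mul (by positivity), sphConst]
      congr 1; ring

lemma logPolarMeasure_small_le' {n d : ℕ} (hd : 1 ≤ d) {c : Finset (Fin n) → ℝ}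
    (hc : ∀ S : Finset (Fin n), d < S.card → c S = 0) (X Y Z : Fin n → ℝ)
    (hY : multilin c Y ≠ 0) {r : ℝ} (hr : 0 ≤ r) :
    logPolarMeasure {p | |multilin c (sphComb (logPolar p) X Y Z)| ≤ r ^ d} ≤
      ENNReal.ofReal (sphConst * r / |multilin c Y| ^ (1 / d : ℝ)) := by
  refine le_trans (le_of_eq ?_) (logPolarMeasure_small_le hd hc Y X Z hY hr)
  have hm : MeasurableSet {p | |multilin c (sphComb (logPolar p) Y X Z)| ≤ r ^ d} := by
    have h1 := ((measurable_multilin c).comp (measurable_sphComb Y X Z)).comp measurable_logPolar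
    exact measurableSet_le (continuous_abs.measurable.comp h1) measurable_const
  rw [← measurePreserving_neg_fst_logPolarMeasure.measure_preimage hm.nullMeasurableSet]
  congr 1
  ext p
  simp only [Set.mem_ofPred_eq, Set.mem_preimage]
  rw [sphComb_logPolar_neg]

/-- A law on the line whose first three moments are those of a standard Gaussian and whose fourth
moment is at most the Gaussian one. -/
structure HasGaussianMoments (ν : Measure ℝ) : Prop where
  prob : IsProbabilityMeasure ν
  memLp : MemLp id 4 ν
  mean : ∫ x, x ∂ν = 0
  second : ∫ x, x ^ 2 ∂ν = 1
  third : ∫ x, x ^ 3 ∂ν = 0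
  fourth : ∫ x, x ^ 4 ∂ν ≤ 3

lemma HasGaussianMoments.integrable_pow {ν : Measure ℝ} (h : HasGaussianMoments ν) {k : ℕ}
    (hk : k ≤ 4) : Integrable (fun x : ℝ => x ^ k) ν := by
  have := h.prob
  have h1 : MemLp id (k : ENNReal) ν := h.memLp.mono_exponent (by exact_mod_cast hk)
  have h2 := h1.integrable_norm_pow'
  refine h2.mono' (by fun_prop) (Filter.Eventually.of_forall fun x => ?_)
  simp

lemma integral_odd_gaussianReal {g : ℝ → ℝ} (hg : ∀ x, g (-x) = -g x) (hgm : Measurable g) :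
    ∫ x, g x ∂(gaussianReal 0 1) = 0 := by
  have h := gaussianReal_map_neg (μ := 0) (v := 1)
  rw [neg_zero] at h
  have h1 : ∫ x, g x ∂(gaussianReal 0 1) = ∫ x, g (-x) ∂(gaussianReal 0 1) := by
    conv_lhs => rw [← h]
    rw [integral_map (by fun_prop) hgm.aestronglyMeasurable]
  simp_rw [hg, integral_neg] at h1
  linarith

lemma hasGaussianMoments_gaussianReal : HasGaussianMoments (gaussianReal 0 1) := by
  have hmem : MemLp id 4 (gaussianReal 0 1) := memLp_id_gaussianReal' 4 (by norm_num)
  have hint : ∀ k : ℕ, k ≤ 4 → Integrable (fun x : ℝ => x ^ k) (gaussianReal 0 1) := by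
    intro k hk
    have h1 : MemLp id (k : ENNReal) (gaussianReal 0 1) := hmem.mono_exponent (by exact_mod_cast hk)
    refine h1.integrable_norm_pow'.mono' (by fun_prop) (Filter.Eventually.of_forall fun x => ?_)
    simp
  have h1 : ∫ x, x ∂(gaussianReal 0 1) = 0 := integral_odd_gaussianReal (by simp) (by fun_prop)
  have h2 : ∫ x, x ^ 2 ∂(gaussianReal 0 1) = 1 := by
    have h := variance_fun_id_gaussianReal (μ := 0) (v := 1)
    rw [variance_of_integral_eq_zero (by fun_prop) h1] at h
    simpa using h
  have h3 : ∫ x, x ^ 3 ∂(gaussianReal 0 1) = 0 :=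
    integral_odd_gaussianReal (fun x => by ring) (by fun_prop)
  refine ⟨inferInstance, hmem, h1, h2, h3, le_of_eq ?_⟩
  have hrot := IsGaussian.map_rotation_eq_self_of_forall_strongDual_eq_zero
    (μ := gaussianReal 0 1) (fun L => integral_odd_gaussianReal (by simp) (by fun_prop))
    (Real.pi / 4)
  set γ := gaussianReal 0 1
  have hm : AEStronglyMeasurable (fun p : ℝ × ℝ => p.1 ^ 4) (γ.prod γ) := by fun_prop
  have e1 : ∫ p, p.1 ^ 4 ∂(γ.prod γ) = ∫ x, x ^ 4 ∂γ := by
    have := integral_prod_mul (μ := γ) (ν := γ) (fun x : ℝ => x ^ 4) (fun _ => (1 : ℝ))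
    simpa using this
  have e2 : ∫ p, p.1 ^ 4 ∂(γ.prod γ) =
      ∫ p, (1 / 4) * (p.1 ^ 4 + 4 * (p.1 ^ 3 * p.2 ^ 1) + 6 * (p.1 ^ 2 * p.2 ^ 2) +
        4 * (p.1 ^ 1 * p.2 ^ 3) + p.2 ^ 4) ∂(γ.prod γ) := by
    conv_lhs => rw [← hrot]
    rw [integral_map (by fun_prop) (by fun_prop)]
    refine integral_congr_ae (Filter.Eventually.of_forall fun p => ?_)
    simp only [ContinuousLinearMap.rotation_apply, Real.cos_pi_div_four, Real.sin_pi_div_four,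
      smul_eq_mul]
    have : √2 ^ 4 = 4 := by
      rw [show √2 ^ 4 = (√2 ^ 2) ^ 2 by ring, Real.sq_sqrt (by norm_num)]; norm_num
    linear_combination (1 / 16) * (p.1 + p.2) ^ 4 * this
  have hi : ∀ j k : ℕ, j ≤ 4 → k ≤ 4 → Integrable (fun p : ℝ × ℝ => p.1 ^ j * p.2 ^ k) (γ.prod γ) :=
    fun j k hj hk => (hint j hj).mul_prod (hint k hk)
  have hi1 : Integrable (fun p : ℝ × ℝ => p.1 ^ 4) (γ.prod γ) := by simpa using hi 4 0 le_rfl (by simp)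
  have hi2 : Integrable (fun p : ℝ × ℝ => p.2 ^ 4) (γ.prod γ) := by simpa using hi 0 4 (by simp) le_rfl
  have e3 : ∫ p, p.2 ^ 4 ∂(γ.prod γ) = ∫ x, x ^ 4 ∂γ := by
    have := integral_prod_mul (μ := γ) (ν := γ) (fun _ : ℝ => (1 : ℝ)) (fun x => x ^ 4)
    simpa using this
  rw [integral_const_mul, integral_add, integral_add, integral_add, integral_add,
    integral_const_mul, integral_const_mul, integral_const_mul, e1, e3,
    integral_prod_mul (μ := γ) (ν := γ) (fun x : ℝ => x ^ 3) (fun x => x ^ 1),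
    integral_prod_mul (μ := γ) (ν := γ) (fun x : ℝ => x ^ 2) (fun x => x ^ 2),
    integral_prod_mul (μ := γ) (ν := γ) (fun x : ℝ => x ^ 1) (fun x => x ^ 3), h2, h3] at e2
  · linarith
  · exact hi1
  · exact (hi 3 1 (by norm_num) (by norm_num)).const_mul _
  · exact hi1.add ((hi 3 1 (by norm_num) (by norm_num)).const_mul _)
  · exact (hi 2 2 (by norm_num) (by norm_num)).const_mul _
  · exact (hi1.add ((hi 3 1 (by norm_num) (by norm_num)).const_mul _)).add
      ((hi 2 2 (by norm_num) (by norm_num)).const_mul _)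
  · exact (hi 1 3 (by norm_num) (by norm_num)).const_mul _
  · exact ((hi1.add ((hi 3 1 (by norm_num) (by norm_num)).const_mul _)).add
      ((hi 2 2 (by norm_num) (by norm_num)).const_mul _)).add
      ((hi 1 3 (by norm_num) (by norm_num)).const_mul _)
  · exact hi2

section Product

variable {n : ℕ} {ν : Fin n → Measure ℝ}

lemma memLp_four_prod (hν : ∀ i, HasGaussianMoments (ν i))
    (S : Finset (Fin n)) :
    MemLp (fun x : Fin n → ℝ => ∏ i ∈ S, x i) 4 (Measure.pi ν) := by
  have := fun i => (hν i).prob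
  rw [← integrable_norm_rpow_iff (by fun_prop) (by norm_num) (by norm_num)]
  have h : Integrable (fun x : Fin n → ℝ => ∏ i, (if i ∈ S then (x i) ^ 4 else 1))
      (Measure.pi ν) := by
    refine Integrable.fintype_prod_dep (f := fun i x => if i ∈ S then x ^ 4 else 1) fun i => ?_
    by_cases hi : i ∈ S
    · simpa [hi] using (hν i).integrable_pow le_rfl
    · simp [hi]
  refine h.congr (Filter.Eventually.of_forall fun x => ?_)
  have h4 : ENNReal.toReal 4 = ((4 : ℕ) : ℝ) := by norm_num
  simp only [h4, Real.rpow_natCast]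
  rw [Finset.prod_ite_mem, Finset.univ_inter, Real.norm_eq_abs,
    Even.pow_abs (by decide), Finset.prod_pow]

lemma memLp_four_multilin (hν : ∀ i, HasGaussianMoments (ν i))
    (c : Finset (Fin n) → ℝ) : MemLp (multilin c) 4 (Measure.pi ν) := by
  have h : MemLp (fun x : Fin n → ℝ => ∑ S : Finset (Fin n), c S * ∏ i ∈ S, x i) 4 (Measure.pi ν) :=
    memLp_finsetSum _ fun S _ => (memLp_four_prod hν S).const_mul _
  exact h

lemma memLp_two_multilin (hν : ∀ i, HasGaussianMoments (ν i))
    (c : Finset (Fin n) → ℝ) : MemLp (multilin c) 2 (Measure.pi ν) := by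
  have := fun i => (hν i).prob
  exact (memLp_four_multilin hν c).mono_exponent (by norm_num)

lemma integral_prod_mul_prod (hν : ∀ i, HasGaussianMoments (ν i))
    (S T : Finset (Fin n)) :
    ∫ x, (∏ i ∈ S, x i) * ∏ i ∈ T, x i ∂(Measure.pi ν) = if S = T then 1 else 0 := by
  have := fun i => (hν i).prob
  have h : ∀ x : Fin n → ℝ, (∏ i ∈ S, x i) * ∏ i ∈ T, x i =
      ∏ i, ((if i ∈ S then x i else 1) * (if i ∈ T then x i else 1)) := fun x => by
    rw [Finset.prod_mul_distrib, Finset.prod_ite_mem, Finset.prod_ite_mem, Finset.univ_inter,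
      Finset.univ_inter]
  simp_rw [h]
  rw [integral_fintype_prod_eq_prod
    (fun i x => (if i ∈ S then x else 1) * (if i ∈ T then x else 1))]
  by_cases hST : S = T
  · rw [if_pos hST]
    refine Finset.prod_eq_one fun i _ => ?_
    subst hST
    by_cases hi : i ∈ S
    · simp only [hi, if_true, ← sq]; exact (hν i).second
    · simp [hi]
  · rw [if_neg hST]
    obtain ⟨i, hi⟩ : ∃ i, ¬ (i ∈ S ↔ i ∈ T) := by
      by_contra hcon
      push Not at hcon
      exact hST (Finset.ext hcon)
    refine Finset.prod_eq_zero (Finset.mem_univ i) ?_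
    by_cases h1 : i ∈ S <;> by_cases h2 : i ∈ T
    · tauto
    · simp [h1, h2, (hν i).mean]
    · simp [h1, h2, (hν i).mean]
    · tauto

lemma integral_multilin_mul_multilin (hν : ∀ i, HasGaussianMoments (ν i))
    (c c' : Finset (Fin n) → ℝ) :
    ∫ x, multilin c x * multilin c' x ∂(Measure.pi ν) = ∑ S, c S * c' S := by
  have := fun i => (hν i).prob
  have hi : ∀ S T : Finset (Fin n), Integrable (fun x : Fin n → ℝ =>
      (∏ i ∈ S, x i) * ∏ i ∈ T, x i) (Measure.pi ν) := fun S T =>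
    MemLp.integrable_mul (p := 2) (q := 2) ((memLp_four_prod hν S).mono_exponent (by norm_num))
      ((memLp_four_prod hν T).mono_exponent (by norm_num))
  have h : ∀ x : Fin n → ℝ, multilin c x * multilin c' x = ∑ S : Finset (Fin n),
      ∑ T : Finset (Fin n), c S * c' T * ((∏ i ∈ S, x i) * ∏ i ∈ T, x i) := fun x => by
    rw [multilin, multilin, Finset.sum_mul_sum]
    refine Finset.sum_congr rfl fun S _ => Finset.sum_congr rfl fun T _ => by ring
  simp_rw [h]
  rw [integral_finsetSum _ fun S _ => integrable_finsetSum _ fun T _ => (hi S T).const_mul _]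
  refine Finset.sum_congr rfl fun S _ => ?_
  rw [integral_finsetSum _ fun T _ => (hi S T).const_mul _]
  simp_rw [integral_const_mul, integral_prod_mul_prod hν]
  simp

lemma integral_multilin_sq (hν : ∀ i, HasGaussianMoments (ν i))
    (c : Finset (Fin n) → ℝ) :
    ∫ x, multilin c x ^ 2 ∂(Measure.pi ν) = ∑ S, c S ^ 2 := by
  simp_rw [sq, integral_multilin_mul_multilin hν]

end Product

instance isProbabilityMeasure_gaussianPi (n : ℕ) : IsProbabilityMeasure (gaussianPi n) := by
  unfold gaussianPi; infer_instance

instance isGaussian_gaussianPi (n : ℕ) : IsGaussian (gaussianPi n) := by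
  rw [← isGaussian_map_equiv_iff (PiLp.continuousLinearEquiv 2 ℝ fun _ : Fin n => ℝ).symm]
  have h := map_pi_eq_stdGaussian (ι := Fin n)
  have h2 : ((gaussianPi n).map (PiLp.continuousLinearEquiv 2 ℝ fun _ : Fin n => ℝ).symm) =
      stdGaussian (EuclideanSpace ℝ (Fin n)) := h
  rw [h2]
  infer_instance

lemma integral_dual_gaussianPi {n : ℕ} (L : StrongDual ℝ (Fin n → ℝ)) :
    (gaussianPi n)[L] = 0 := by
  have hmp : MeasurePreserving (fun x : Fin n → ℝ => fun i => -x i) (gaussianPi n)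
      (gaussianPi n) := by
    unfold gaussianPi
    refine measurePreserving_pi _ _ fun i => ⟨by fun_prop, ?_⟩
    have h := gaussianReal_map_neg (μ := 0) (v := 1)
    rwa [neg_zero] at h
  have h1 : ∫ x, L x ∂(gaussianPi n) = ∫ x, L (-x) ∂(gaussianPi n) := by
    conv_lhs => rw [← hmp.map_eq]
    rw [integral_map hmp.measurable.aemeasurable (by fun_prop)]
    rfl
  simp_rw [map_neg, integral_neg] at h1
  linarith

/-- Rotating a pair of independent standard Gaussian vectors does not change its law. -/
lemma measurePreserving_rotation_gaussianPi {n : ℕ} {a b : ℝ} (h : a ^ 2 + b ^ 2 = 1) :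
    MeasurePreserving (fun p : (Fin n → ℝ) × (Fin n → ℝ) =>
      (a • p.1 + b • p.2, -b • p.1 + a • p.2)) ((gaussianPi n).prod (gaussianPi n))
      ((gaussianPi n).prod (gaussianPi n)) := by
  refine ⟨by fun_prop, ?_⟩
  set z : ℂ := ⟨a, b⟩
  have hz : ‖z‖ = 1 := by
    rw [Complex.norm_def, Complex.normSq_mk, ← sq, ← sq, h, Real.sqrt_one]
  have hz0 : z ≠ 0 := by intro h0; simp [h0] at hz
  have hc : Real.cos z.arg = a := by rw [Complex.cos_arg hz0, hz, div_one]
  have hs : Real.sin z.arg = b := by rw [Complex.sin_arg, hz, div_one]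
  have := IsGaussian.map_rotation_eq_self_of_forall_strongDual_eq_zero (μ := gaussianPi n)
    integral_dual_gaussianPi z.arg
  conv_rhs => rw [← this]
  congr 1
  funext p
  rw [ContinuousLinearMap.rotation_apply, hc, hs]

lemma measurePreserving_comb_gaussianPi {n : ℕ} {a b : ℝ} (h : a ^ 2 + b ^ 2 = 1) :
    MeasurePreserving (fun p : (Fin n → ℝ) × (Fin n → ℝ) => a • p.1 + b • p.2)
      ((gaussianPi n).prod (gaussianPi n)) (gaussianPi n) :=
  measurePreserving_fst.comp (measurePreserving_rotation_gaussianPi h)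

lemma hasGaussianMoments_gaussianPi {n : ℕ} :
    ∀ _ : Fin n, HasGaussianMoments (gaussianReal 0 1) := fun _ => hasGaussianMoments_gaussianReal

lemma integral_multilin_comb_gaussianPi {n : ℕ} (c : Finset (Fin n) → ℝ) (a b : ℝ)
    (x : Fin n → ℝ) :
    ∫ v, multilin c (a • x + b • v) ∂(gaussianPi n) = multilin (fun S => c S * a ^ S.card) x := by
  have hint : ∀ i, Integrable (fun v : ℝ => a * x i + b * v) (gaussianReal 0 1) := fun i =>
    (integrable_const _).add
      ((hasGaussianMoments_gaussianReal.integrable_pow (k := 1) (by norm_num)).congr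
        (by simp) |>.const_mul b)
  have hprod : ∀ S : Finset (Fin n), ∀ v : Fin n → ℝ, ∏ i ∈ S, (a • x + b • v) i =
      ∏ i, (if i ∈ S then a * x i + b * v i else 1) := fun S v => by
    rw [Finset.prod_ite_mem, Finset.univ_inter]; rfl
  unfold multilin gaussianPi
  simp_rw [hprod]
  rw [integral_finsetSum]
  · refine Finset.sum_congr rfl fun S _ => ?_
    rw [integral_const_mul, integral_fintype_prod_eq_prod
      (fun i v => if i ∈ S then a * x i + b * v else 1), mul_assoc, ← Finset.prod_const,
      ← Finset.prod_mul_distrib]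
    congr 1
    have : ∀ i, ∫ v, (if i ∈ S then a * x i + b * v else 1) ∂(gaussianReal 0 1) =
        if i ∈ S then a * x i else 1 := fun i => by
      by_cases hi : i ∈ S
      · simp only [hi, if_true]
        rw [integral_add (integrable_const _), integral_const_mul (μ := gaussianReal 0 1) b,
          hasGaussianMoments_gaussianReal.mean]
        · simp
        · exact ((hasGaussianMoments_gaussianReal.integrable_pow (k := 1) (by norm_num)).congr
            (by simp)).const_mul b
      · simp [hi]
    simp_rw [this]
    rw [Finset.prod_ite_mem, Finset.univ_inter]
  · intro S _
    refine Integrable.const_mul ?_ _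
    refine Integrable.fintype_prod_dep (f := fun i v => if i ∈ S then a * x i + b * v else 1)
      fun i => ?_
    by_cases hi : i ∈ S
    · simpa [hi] using hint i
    · simp [hi]

lemma memLp_multilin_comb_gaussianPi {n : ℕ} (c : Finset (Fin n) → ℝ) {a b : ℝ}
    (h : a ^ 2 + b ^ 2 = 1) :
    MemLp (fun p : (Fin n → ℝ) × (Fin n → ℝ) => multilin c (a • p.1 + b • p.2)) 2
      ((gaussianPi n).prod (gaussianPi n)) :=
  (memLp_two_multilin hasGaussianMoments_gaussianPi c).comp_measurePreserving
    (measurePreserving_comb_gaussianPi h)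

lemma memLp_multilin_fst_gaussianPi {n : ℕ} (c : Finset (Fin n) → ℝ) :
    MemLp (fun p : (Fin n → ℝ) × (Fin n → ℝ) => multilin c p.1) 2
      ((gaussianPi n).prod (gaussianPi n)) :=
  (memLp_two_multilin hasGaussianMoments_gaussianPi c).comp_measurePreserving
    measurePreserving_fst

lemma integral_multilin_mul_multilin_comb {n : ℕ} (c : Finset (Fin n) → ℝ) {a b : ℝ}
    (h : a ^ 2 + b ^ 2 = 1) :
    ∫ p, multilin c p.1 * multilin c (a • p.1 + b • p.2) ∂((gaussianPi n).prod (gaussianPi n)) =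
      ∑ S, c S ^ 2 * a ^ S.card := by
  have hi : Integrable (fun p => multilin c p.1 * multilin c (a • p.1 + b • p.2))
      ((gaussianPi n).prod (gaussianPi n)) :=
    (memLp_multilin_fst_gaussianPi c).integrable_mul (memLp_multilin_comb_gaussianPi c h)
  rw [integral_prod _ hi]
  simp_rw [integral_const_mul, integral_multilin_comb_gaussianPi]
  have := integral_multilin_mul_multilin (hasGaussianMoments_gaussianPi (n := n)) c
    (fun S => c S * a ^ S.card)
  unfold gaussianPi
  rw [this]
  exact Finset.sum_congr rfl fun S _ => by ring

/-- Two Gaussian vectors with correlation close to one: the values of a low-degree polynomial at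
the first, weighted by an event on the orthogonal direction, keep half of their mass. -/
lemma le_integral_multilin_sq_mul_indicator {n d : ℕ} {c : Finset (Fin n) → ℝ}
    (hc : ∀ S : Finset (Fin n), d < S.card → c S = 0) {F : Set (Fin n → ℝ)}
    (hF : MeasurableSet F) {ρ κ : ℝ} (h : κ ^ 2 + ρ ^ 2 = 1) (hκ : 0 ≤ κ)
    (hu : d * ρ ^ 2 ≤ ((gaussianPi n) F).toReal ^ 2 / 32) :
    (∑ S, c S ^ 2) * ((gaussianPi n) F).toReal / 2 ≤
      ∫ p, multilin c p.1 ^ 2 * F.indicator 1 (ρ • p.1 + κ • p.2)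
        ∂((gaussianPi n).prod (gaussianPi n)) := by
  set μ := gaussianPi n with hμ
  set u := (μ F).toReal with hudef
  set N := ∑ S, c S ^ 2 with hN
  have hN0 : 0 ≤ N := Finset.sum_nonneg fun S _ => sq_nonneg _
  have hu0 : 0 ≤ u := ENNReal.toReal_nonneg
  have hu1 : u ≤ 1 := by
    have : μ F ≤ 1 := prob_le_one
    exact ENNReal.toReal_le_of_le_ofReal zero_le_one (by simpa using this)
  have h' : κ ^ 2 + (-ρ) ^ 2 = 1 := by rw [neg_sq]; exact h
  set f := multilin c with hf
  set A : (Fin n → ℝ) × (Fin n → ℝ) → ℝ := fun p => f p.1 with hA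
  set B : (Fin n → ℝ) × (Fin n → ℝ) → ℝ := fun p => f (κ • p.1 + (-ρ) • p.2) with hB
  set I : (Fin n → ℝ) × (Fin n → ℝ) → ℝ := fun p => F.indicator 1 (ρ • p.1 + κ • p.2) with hI
  have hAm : MemLp A 2 (μ.prod μ) := memLp_multilin_fst_gaussianPi c
  have hBm : MemLp B 2 (μ.prod μ) := memLp_multilin_comb_gaussianPi c h'
  have hIm : Measurable I := by
    have h1 : Measurable (F.indicator (1 : (Fin n → ℝ) → ℝ)) := measurable_one.indicator hF
    exact h1.comp (by fun_prop)
  have hI0 : ∀ p, 0 ≤ I p := fun p => Set.indicator_nonneg (fun _ _ => zero_le_one) _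
  have hI1 : ∀ p, I p ≤ 1 := fun p => Set.indicator_le' (fun _ _ => le_rfl)
    (fun _ _ => zero_le_one) _
  have iA := hAm.integrable_sq
  have iB := hBm.integrable_sq
  have iAB : Integrable (fun p => A p * B p) (μ.prod μ) := hAm.integrable_mul hBm
  have iAI : Integrable (fun p => A p ^ 2 * I p) (μ.prod μ) :=
    iA.mul_bdd (c := 1) hIm.aestronglyMeasurable (Filter.Eventually.of_forall fun p => by
      rw [Real.norm_eq_abs, abs_of_nonneg (hI0 p)]; exact hI1 p)
  have iBI : Integrable (fun p => B p ^ 2 * I p) (μ.prod μ) :=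
    iB.mul_bdd (c := 1) hIm.aestronglyMeasurable (Filter.Eventually.of_forall fun p => by
      rw [Real.norm_eq_abs, abs_of_nonneg (hI0 p)]; exact hI1 p)
  have eA : ∫ p, A p ^ 2 ∂(μ.prod μ) = N := by
    rw [hN, ← integral_multilin_sq hasGaussianMoments_gaussianPi c]
    have := (measurePreserving_fst (μ := μ) (ν := μ)).map_eq
    conv_rhs => rw [show (Measure.pi fun _ : Fin n => gaussianReal 0 1) = μ from rfl, ← this]
    rw [integral_map (by fun_prop) (by fun_prop)]
  have eB : ∫ p, B p ^ 2 ∂(μ.prod μ) = N := by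
    rw [hN, ← integral_multilin_sq hasGaussianMoments_gaussianPi c]
    have := (measurePreserving_comb_gaussianPi (n := n) h').map_eq
    rw [← hμ] at this
    conv_rhs => rw [show (Measure.pi fun _ : Fin n => gaussianReal 0 1) = μ from rfl, ← this]
    rw [integral_map (by fun_prop) (by fun_prop)]
  have eAB : ∫ p, A p * B p ∂(μ.prod μ) = ∑ S, c S ^ 2 * κ ^ S.card :=
    integral_multilin_mul_multilin_comb c h'
  have eBI : ∫ p, B p ^ 2 * I p ∂(μ.prod μ) = N * u := by
    have hmp := measurePreserving_rotation_gaussianPi (n := n) h'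
    have h1 : ∫ p, B p ^ 2 * I p ∂(μ.prod μ) =
        ∫ p, f p.1 ^ 2 * F.indicator 1 p.2 ∂(μ.prod μ) := by
      conv_rhs => rw [hμ, ← hmp.map_eq]
      rw [integral_map (by fun_prop)]
      · simp only [hB, hI, neg_neg]; rfl
      · have h1 : Measurable (F.indicator (1 : (Fin n → ℝ) → ℝ)) := measurable_one.indicator hF
        exact (((measurable_multilin c).comp measurable_fst).pow_const 2 |>.mul
          (h1.comp measurable_snd)).aestronglyMeasurable
    rw [h1, integral_prod_mul (μ := μ) (ν := μ) (fun x => f x ^ 2) (F.indicator 1),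
      integral_indicator_one hF]
    congr 1
    exact integral_multilin_sq hasGaussianMoments_gaussianPi c
  have hcorr : N * (1 - d * ρ ^ 2) ≤ ∑ S, c S ^ 2 * κ ^ S.card := by
    have hκ1 : κ ≤ 1 := by nlinarith [sq_nonneg ρ]
    rw [hN, Finset.sum_mul]
    refine Finset.sum_le_sum fun S _ => ?_
    by_cases hS : d < S.card
    · simp [hc S hS]
    · refine mul_le_mul_of_nonneg_left ?_ (sq_nonneg _)
      have h1 := one_add_mul_le_pow (a := κ - 1) (by linarith) d
      have h2 : κ ^ d ≤ κ ^ S.card := pow_le_pow_of_le_one hκ hκ1 (not_lt.1 hS)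
      rw [add_sub_cancel] at h1
      have h3 : -ρ ^ 2 ≤ κ - 1 := by nlinarith
      have h4 : (d : ℝ) * (-ρ ^ 2) ≤ d * (κ - 1) := mul_le_mul_of_nonneg_left h3 (by positivity)
      linarith
  rcases hu0.eq_or_lt with hu0 | hu0
  · rw [← hu0]
    simp only [mul_zero, zero_div]
    exact integral_nonneg fun p => mul_nonneg (sq_nonneg _) (hI0 p)
  have hpt : ∀ p, B p ^ 2 * I p - A p ^ 2 * I p ≤
      (4 / u) * (A p ^ 2 + B p ^ 2 - 2 * (A p * B p)) +
        (u / 16) * (A p ^ 2 + B p ^ 2 + 2 * (A p * B p)) := fun p => by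
    have h1 : B p ^ 2 - A p ^ 2 ≤ (4 / u) * (A p - B p) ^ 2 + (u / 16) * (A p + B p) ^ 2 := by
      have : (4 / u) * (A p - B p) ^ 2 + (u / 16) * (A p + B p) ^ 2 - (B p ^ 2 - A p ^ 2) =
          (1 / (16 * u)) * (8 * (A p - B p) + u * (A p + B p)) ^ 2 := by
        field_simp; ring
      have h2 : 0 ≤ (1 / (16 * u)) * (8 * (A p - B p) + u * (A p + B p)) ^ 2 := by positivity
      linarith
    have h3 : 0 ≤ (4 / u) * (A p - B p) ^ 2 + (u / 16) * (A p + B p) ^ 2 := by positivity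
    nlinarith [hI0 p, hI1 p, mul_nonneg (hI0 p) (sub_nonneg.2 h1),
      mul_nonneg (sub_nonneg.2 (hI1 p)) h3]
  have iS : Integrable (fun p => A p ^ 2 + B p ^ 2) (μ.prod μ) := iA.add iB
  have hmono := integral_mono (iBI.sub iAI) (((iS.sub (iAB.const_mul 2)).const_mul (4 / u)).add
    ((iS.add (iAB.const_mul 2)).const_mul (u / 16))) hpt
  rw [integral_sub' iBI iAI, integral_add' ((iS.sub (iAB.const_mul 2)).const_mul (4 / u))
    ((iS.add (iAB.const_mul 2)).const_mul (u / 16)), integral_const_mul, integral_const_mul,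
    integral_sub' iS (iAB.const_mul 2), integral_add' iS (iAB.const_mul 2), integral_const_mul,
    integral_add iA iB, eA, eB, eAB, eBI] at hmono
  have hNN : ∑ S, c S ^ 2 * κ ^ S.card ≤ N := by
    have hκ1 : κ ≤ 1 := by nlinarith [sq_nonneg ρ]
    refine Finset.sum_le_sum fun S _ => ?_
    exact mul_le_of_le_one_right (sq_nonneg _) (pow_le_one₀ hκ hκ1)
  have k1 : (4 / u) * (N + N - 2 * ∑ S, c S ^ 2 * κ ^ S.card) ≤ N * u / 4 := by
    calc (4 / u) * (N + N - 2 * ∑ S, c S ^ 2 * κ ^ S.card)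
        ≤ (4 / u) * (2 * N * (u ^ 2 / 32)) := by
          refine mul_le_mul_of_nonneg_left ?_ (by positivity)
          have := mul_le_mul_of_nonneg_left hu hN0
          linarith
      _ = N * u / 4 := by field_simp; ring
  have k2 : (u / 16) * (N + N + 2 * ∑ S, c S ^ 2 * κ ^ S.card) ≤ N * u / 4 := by
    calc (u / 16) * (N + N + 2 * ∑ S, c S ^ 2 * κ ^ S.card) ≤ (u / 16) * (N + N + 2 * N) := by
          refine mul_le_mul_of_nonneg_left ?_ (by positivity); linarith
      _ = N * u / 4 := by ring
  have : ∫ p, A p ^ 2 * I p ∂(μ.prod μ) = ∫ p, f p.1 ^ 2 * F.indicator 1 (ρ • p.1 + κ • p.2)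
        ∂(μ.prod μ) := rfl
  linarith

lemma measurable_sphComb_uncurry {n : ℕ} :
    Measurable fun z : ℂ × (Fin n → ℝ) × (Fin n → ℝ) × (Fin n → ℝ) =>
      sphComb z.1 z.2.1 z.2.2.1 z.2.2.2 := by
  unfold sphComb
  have : Measurable Complex.normSq := Complex.continuous_normSq.measurable
  refine measurable_pi_lambda _ fun i => ?_
  fun_prop

lemma sphComb_eq {n : ℕ} {w : ℂ} (hw : w ≠ 0) (X Y Z : Fin n → ℝ) :
    sphComb w X Y Z = ((‖w‖ ^ 2 - 1) / (1 + ‖w‖ ^ 2)) • X +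
      (2 * ‖w‖ / (1 + ‖w‖ ^ 2)) • ((w.re / ‖w‖) • Y + (w.im / ‖w‖) • Z) := by
  have h0 : ‖w‖ ≠ 0 := norm_ne_zero_iff.2 hw
  funext i
  simp only [sphComb, Pi.add_apply, Pi.smul_apply, smul_eq_mul, Complex.normSq_eq_norm_sq]
  field_simp
  ring

/-- `sphComb w` preserves a fixed fraction of the squared mass when `w` is near the unit circle. -/
lemma le_lintegral_sphComb {n d : ℕ} (hd : 1 ≤ d) {c : Finset (Fin n) → ℝ}
    (hc : ∀ S : Finset (Fin n), d < S.card → c S = 0) {F : Set (Fin n → ℝ)}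
    (hF : MeasurableSet F) {w : ℂ} (hw1 : 1 ≤ ‖w‖)
    (hw2 : ‖w‖ ≤ 1 + ((gaussianPi n) F).toReal / (9 * d)) :
    ENNReal.ofReal ((∑ S, c S ^ 2) * ((gaussianPi n) F).toReal / 2) ≤
      ∫⁻ q, ENNReal.ofReal (multilin c q.1 ^ 2) * F.indicator 1 (sphComb w q.1 q.2.1 q.2.2)
        ∂((gaussianPi n).prod ((gaussianPi n).prod (gaussianPi n))) := by
  set μ := gaussianPi n with hμ
  set u := (μ F).toReal with hudef
  have hu0 : 0 ≤ u := ENNReal.toReal_nonneg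
  have hu1 : u ≤ 1 := by
    have : μ F ≤ 1 := prob_le_one
    exact ENNReal.toReal_le_of_le_ofReal zero_le_one (by simpa using this)
  have hd1 : (1 : ℝ) ≤ d := by exact_mod_cast hd
  have hw0 : w ≠ 0 := by
    intro h; rw [h, norm_zero] at hw1; linarith
  set a := ‖w‖ with ha
  set ρ := (a ^ 2 - 1) / (1 + a ^ 2) with hρ
  set κ := 2 * a / (1 + a ^ 2) with hκ
  have hden : 0 < 1 + a ^ 2 := by positivity
  have hκ0 : 0 ≤ κ := by positivity
  have hρκ : κ ^ 2 + ρ ^ 2 = 1 := by rw [hρ, hκ]; field_simp; ring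
  have hcs : (w.re / a) ^ 2 + (w.im / a) ^ 2 = 1 := by
    have h1 : a ^ 2 = w.re * w.re + w.im * w.im := by
      rw [ha, ← Complex.normSq_eq_norm_sq, Complex.normSq_apply]
    have h2 : a ^ 2 ≠ 0 := by positivity
    rw [div_pow, div_pow, ← add_div, div_eq_one_iff_eq h2, h1]; ring
  have hρ0 : 0 ≤ ρ := div_nonneg (by nlinarith) hden.le
  have hs : u / (9 * d) ≤ 1 := by
    rw [div_le_one (by positivity)]; nlinarith
  have hs0 : 0 ≤ u / (9 * d) := by positivity
  have hρ1 : ρ ≤ u / (6 * d) := by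
    have h1 : ρ ≤ 3 / 2 * (u / (9 * d)) := by
      rw [hρ, div_le_iff₀ hden]
      have k1 : (a - 1) * (a + 1) ≤ u / (9 * d) * (a + 1) :=
        mul_le_mul_of_nonneg_right (by linarith) (by linarith)
      have k2 : a + 1 ≤ 3 / 2 * (1 + a ^ 2) := by nlinarith [sq_nonneg (3 * a - 1)]
      have k3 := mul_le_mul_of_nonneg_left k2 hs0
      linarith
    calc ρ ≤ 3 / 2 * (u / (9 * d)) := h1
      _ = u / (6 * d) := by field_simp; ring
  have hu : d * ρ ^ 2 ≤ u ^ 2 / 32 := by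
    calc d * ρ ^ 2 ≤ d * (u / (6 * d)) ^ 2 := by gcongr
      _ = u ^ 2 / 36 * (1 / d) := by field_simp; norm_num
      _ ≤ u ^ 2 / 36 * 1 := by
          refine mul_le_mul_of_nonneg_left ?_ (by positivity)
          rw [div_le_one (by positivity)]; exact hd1
      _ ≤ u ^ 2 / 32 := by nlinarith [sq_nonneg u]
  have hmain := le_integral_multilin_sq_mul_indicator hc hF hρκ hκ0 hu
  have hmp : MeasurePreserving (fun q : (Fin n → ℝ) × (Fin n → ℝ) × (Fin n → ℝ) =>
      (q.1, (w.re / a) • q.2.1 + (w.im / a) • q.2.2)) (μ.prod (μ.prod μ)) (μ.prod μ) :=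
    (MeasurePreserving.id μ).prod (measurePreserving_comb_gaussianPi hcs)
  have hind : Measurable (F.indicator (1 : (Fin n → ℝ) → ENNReal)) := measurable_one.indicator hF
  have hindR : Measurable (F.indicator (1 : (Fin n → ℝ) → ℝ)) := measurable_one.indicator hF
  have e1 : ∫⁻ q, ENNReal.ofReal (multilin c q.1 ^ 2) *
        F.indicator 1 (sphComb w q.1 q.2.1 q.2.2) ∂(μ.prod (μ.prod μ)) =
      ∫⁻ p, ENNReal.ofReal (multilin c p.1 ^ 2) * F.indicator 1 (ρ • p.1 + κ • p.2)
        ∂(μ.prod μ) := by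
    rw [← hmp.lintegral_comp (f := fun p => ENNReal.ofReal (multilin c p.1 ^ 2) *
      F.indicator 1 (ρ • p.1 + κ • p.2))]
    · simp_rw [sphComb_eq hw0]; rfl
    · exact Measurable.mul (by fun_prop) (hind.comp (by fun_prop))
  rw [e1]
  refine (ENNReal.ofReal_le_ofReal hmain).trans ?_
  rw [integral_eq_lintegral_of_nonneg_ae]
  · refine ENNReal.ofReal_toReal_le.trans (le_of_eq (lintegral_congr fun p => ?_))
    rw [ENNReal.ofReal_mul (sq_nonneg _)]
    congr 1
    by_cases hp : ρ • p.1 + κ • p.2 ∈ F <;> simp [hp]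
  · exact Filter.Eventually.of_forall fun p => mul_nonneg (sq_nonneg _)
      (Set.indicator_nonneg (fun _ _ => zero_le_one) _)
  · exact (Measurable.mul (by fun_prop) (hindR.comp (by fun_prop))).aestronglyMeasurable

lemma sq_div_rpow_le {x : ℝ} (hx : 0 < x) {d : ℕ} (hd : 1 ≤ d) :
    x ^ 2 / x ^ (1 / d : ℝ) ≤ 1 + x ^ 2 := by
  have hd1 : (1 : ℝ) ≤ d := by exact_mod_cast hd
  have hp : 0 < x ^ (1 / d : ℝ) := Real.rpow_pos_of_pos hx _
  rw [div_le_iff₀ hp]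
  rcases le_total 1 x with h | h
  · have := Real.one_le_rpow h (z := (1 / d : ℝ)) (by positivity)
    nlinarith [sq_nonneg x]
  · have h1 : x ≤ x ^ (1 / d : ℝ) := by
      have := Real.rpow_le_rpow_of_exponent_ge hx h (y := 1) (z := (1 / d : ℝ))
        ((div_le_one (by positivity)).2 hd1)
      rwa [Real.rpow_one] at this
    nlinarith [sq_nonneg x]

lemma le_volume_annulus {s : ℝ} (hs : 0 ≤ s) :
    ENNReal.ofReal (2 * Real.pi * s) ≤ volume {w : ℂ | 1 ≤ ‖w‖ ∧ ‖w‖ ≤ 1 + s} := by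
  have h : Metric.closedBall (0 : ℂ) (1 + s) \ Metric.ball 0 1 ⊆
      {w : ℂ | 1 ≤ ‖w‖ ∧ ‖w‖ ≤ 1 + s} := fun w hw => by
    simpa [and_comm] using hw
  refine le_trans ?_ (measure_mono h)
  have h2 : Metric.ball (0 : ℂ) 1 ⊆ Metric.closedBall (0 : ℂ) (1 + s) :=
    Metric.ball_subset_closedBall.trans (Metric.closedBall_subset_closedBall (by linarith))
  rw [measure_sdiff h2 measurableSet_ball.nullMeasurableSet measure_ball_lt_top.ne,
    Complex.volume_ball, Complex.volume_closedBall]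
  have hpi : (NNReal.pi : ENNReal) = ENNReal.ofReal Real.pi := by
    rw [← NNReal.coe_real_pi, ENNReal.ofReal_coe_nnreal]
  rw [hpi, ← ENNReal.ofReal_pow (by linarith), ← ENNReal.ofReal_pow zero_le_one,
    ← ENNReal.ofReal_mul (by positivity), ← ENNReal.ofReal_mul (by positivity),
    ← ENNReal.ofReal_sub _ (by positivity)]
  refine ENNReal.ofReal_le_ofReal ?_
  nlinarith [Real.pi_pos, mul_nonneg Real.pi_pos.le (sq_nonneg s)]

/-- A weak small-ball estimate for low-degree polynomials of Gaussian vectors. -/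
lemma sq_gaussianPi_small_le {n d : ℕ} (hd : 1 ≤ d) {c : Finset (Fin n) → ℝ}
    (hc : ∀ S : Finset (Fin n), d < S.card → c S = 0) (hN : 1 ≤ ∑ S, c S ^ 2) {r : ℝ}
    (hr : 0 ≤ r) :
    ((gaussianPi n) {x | |multilin c x| ≤ r ^ d}).toReal ^ 2 ≤ 3744 * Real.exp 22 * d * r := by
  set μ := gaussianPi n with hμ
  set F : Set (Fin n → ℝ) := {x | |multilin c x| ≤ r ^ d} with hFdef
  have hF : MeasurableSet F := measurableSet_le (by fun_prop) measurable_const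
  set u := (μ F).toReal with hudef
  set N := ∑ S, c S ^ 2 with hNdef
  have hd1 : (1 : ℝ) ≤ d := by exact_mod_cast hd
  have hu0 : 0 ≤ u := ENNReal.toReal_nonneg
  have hu1 : u ≤ 1 := by
    have : μ F ≤ 1 := prob_le_one
    exact ENNReal.toReal_le_of_le_ofReal zero_le_one (by simpa using this)
  set K := 208 * Real.pi * Real.exp 22 with hK
  have hK0 : 0 ≤ K := by have := Real.pi_pos; positivity
  set s := u / (9 * d) with hs
  have hs0 : 0 ≤ s := by positivity
  have hs1 : s ≤ 1 := by rw [hs, div_le_one (by positivity)]; nlinarith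
  set A : Set ℂ := {w | 1 ≤ ‖w‖ ∧ ‖w‖ ≤ 1 + s} with hA
  have hAm : MeasurableSet A :=
    (measurableSet_le measurable_const measurable_norm).inter
      (measurableSet_le measurable_norm measurable_const)
  have hind : Measurable (F.indicator (1 : (Fin n → ℝ) → ENNReal)) := measurable_one.indicator hF
  have h1 : ENNReal.ofReal (N * u / 2) * volume A ≤ ∫⁻ w in A, ∫⁻ q,
      ENNReal.ofReal (multilin c q.1 ^ 2) * F.indicator 1 (sphComb w q.1 q.2.1 q.2.2)
        ∂(μ.prod (μ.prod μ)) := by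
    rw [← setLIntegral_const]
    exact setLIntegral_mono' hAm fun w hw => le_lintegral_sphComb hd hc hF hw.1 hw.2
  have hmeas : Measurable (fun z : ℂ × (Fin n → ℝ) × (Fin n → ℝ) × (Fin n → ℝ) =>
      ENNReal.ofReal (multilin c z.2.1 ^ 2) *
        F.indicator 1 (sphComb z.1 z.2.1 z.2.2.1 z.2.2.2)) :=
    Measurable.mul (by fun_prop) (hind.comp measurable_sphComb_uncurry)
  rw [lintegral_lintegral_swap hmeas.aemeasurable] at h1
  have h2 : ∀ q : (Fin n → ℝ) × (Fin n → ℝ) × (Fin n → ℝ),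
      ∫⁻ w in A, ENNReal.ofReal (multilin c q.1 ^ 2) *
        F.indicator 1 (sphComb w q.1 q.2.1 q.2.2) ≤
      ENNReal.ofReal (K * r * (1 + multilin c q.1 ^ 2)) := fun q => by
    have hm : Measurable fun w => F.indicator (1 : (Fin n → ℝ) → ENNReal)
        (sphComb w q.1 q.2.1 q.2.2) := hind.comp (measurable_sphComb _ _ _)
    rw [lintegral_const_mul _ hm]
    by_cases hq : multilin c q.1 = 0
    · simp [hq]
    have hq0 : 0 < |multilin c q.1| := abs_pos.2 hq
    have h3 : ∫⁻ w in A, F.indicator (1 : (Fin n → ℝ) → ENNReal) (sphComb w q.1 q.2.1 q.2.2) ≤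
        ENNReal.ofReal (K * r / |multilin c q.1| ^ (1 / d : ℝ)) := by
      refine le_trans ?_ (volume_sphComb_small_le hd hc q.1 q.2.1 q.2.2 hq hr)
      have hFm : MeasurableSet {w : ℂ | sphComb w q.1 q.2.1 q.2.2 ∈ F} :=
        measurable_sphComb _ _ _ hF
      have e : (fun w : ℂ => F.indicator (1 : (Fin n → ℝ) → ENNReal)
          (sphComb w q.1 q.2.1 q.2.2)) =
          {w : ℂ | sphComb w q.1 q.2.1 q.2.2 ∈ F}.indicator 1 := by
        funext w; simp [Set.indicator]
      rw [e, lintegral_indicator_one hFm, Measure.restrict_apply hFm]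
      refine measure_mono fun w hw => ⟨?_, hw.1⟩
      have := hw.2.2
      linarith
    calc _ ≤ ENNReal.ofReal (multilin c q.1 ^ 2) *
          ENNReal.ofReal (K * r / |multilin c q.1| ^ (1 / d : ℝ)) := by gcongr
      _ ≤ _ := by
        rw [← ENNReal.ofReal_mul (sq_nonneg _)]
        refine ENNReal.ofReal_le_ofReal ?_
        have h4 := sq_div_rpow_le hq0 hd
        rw [sq_abs] at h4
        calc multilin c q.1 ^ 2 * (K * r / |multilin c q.1| ^ (1 / d : ℝ))
            = K * r * (multilin c q.1 ^ 2 / |multilin c q.1| ^ (1 / d : ℝ)) := by ring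
          _ ≤ _ := mul_le_mul_of_nonneg_left h4 (by positivity)
  have hL2 : MemLp (multilin c) 2 μ := memLp_two_multilin hasGaussianMoments_gaussianPi c
  have hLq : Integrable (fun x => K * r * (1 + multilin c x ^ 2)) μ :=
    ((integrable_const _).add hL2.integrable_sq).const_mul _
  have h5 : ∫⁻ q, (∫⁻ w in A, ENNReal.ofReal (multilin c q.1 ^ 2) *
        F.indicator 1 (sphComb w q.1 q.2.1 q.2.2)) ∂(μ.prod (μ.prod μ)) ≤
      ENNReal.ofReal (K * r * (1 + N)) := by
    refine (lintegral_mono h2).trans (le_of_eq ?_)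
    rw [measurePreserving_fst.lintegral_comp
      (f := fun x => ENNReal.ofReal (K * r * (1 + multilin c x ^ 2))) (by fun_prop),
      ← ofReal_integral_eq_lintegral_ofReal hLq
        (Filter.Eventually.of_forall fun x => by positivity),
      integral_const_mul, integral_add (integrable_const _) hL2.integrable_sq]
    congr 3
    · simp
    · exact integral_multilin_sq hasGaussianMoments_gaussianPi c
  have h6 := (mul_le_mul_right (le_volume_annulus hs0) (ENNReal.ofReal (N * u / 2))).trans
    (h1.trans h5)
  rw [← ENNReal.ofReal_mul (by positivity), ENNReal.ofReal_le_ofReal_iff (by positivity)] at h6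
  have h7 : K * r * (1 + N) ≤ K * r * (2 * N) :=
    mul_le_mul_of_nonneg_left (by linarith) (by positivity)
  have h8 : N * (u ^ 2 * Real.pi / (9 * d)) ≤ N * (2 * (K * r)) := by
    calc N * (u ^ 2 * Real.pi / (9 * d)) = N * u / 2 * (2 * Real.pi * s) := by
          rw [hs]; field_simp
      _ ≤ _ := h6.trans h7
      _ = _ := by ring
  have h9 := le_of_mul_le_mul_left h8 (by linarith)
  rw [div_le_iff₀ (by positivity), hK] at h9
  have hpi := Real.pi_pos
  refine le_of_mul_le_mul_right ?_ hpi
  calc u ^ 2 * Real.pi ≤ _ := h9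
    _ = _ := by ring

lemma measurable_sphComb_logPolar_uncurry {n : ℕ} :
    Measurable fun z : (ℝ × ℝ) × (Fin n → ℝ) × (Fin n → ℝ) × (Fin n → ℝ) =>
      sphComb (logPolar z.1) z.2.1 z.2.2.1 z.2.2.2 := by
  unfold sphComb
  have h1 : Measurable fun z : (ℝ × ℝ) × (Fin n → ℝ) × (Fin n → ℝ) × (Fin n → ℝ) =>
      logPolar z.1 := measurable_logPolar.comp measurable_fst
  have h2 : Measurable fun z : (ℝ × ℝ) × (Fin n → ℝ) × (Fin n → ℝ) × (Fin n → ℝ) =>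
      Complex.normSq (logPolar z.1) := Complex.continuous_normSq.measurable.comp h1
  refine measurable_pi_lambda _ fun i => ?_
  fun_prop

lemma measurePreserving_sphComb {n : ℕ} (w : ℂ) :
    MeasurePreserving (fun q : (Fin n → ℝ) × (Fin n → ℝ) × (Fin n → ℝ) =>
      sphComb w q.1 q.2.1 q.2.2) ((gaussianPi n).prod ((gaussianPi n).prod (gaussianPi n)))
      (gaussianPi n) := by
  by_cases hw : w = 0
  · have h := (measurePreserving_comb_gaussianPi (n := n) (a := -1) (b := 0) (by norm_num)).comp
      ((MeasurePreserving.id (gaussianPi n)).prod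
        (measurePreserving_fst (μ := gaussianPi n) (ν := gaussianPi n)))
    convert h using 1
    funext q i
    simp [sphComb, hw]
  · have h0 : ‖w‖ ≠ 0 := norm_ne_zero_iff.2 hw
    have hcs : (w.re / ‖w‖) ^ 2 + (w.im / ‖w‖) ^ 2 = 1 := by
      have h1 : ‖w‖ ^ 2 = w.re * w.re + w.im * w.im := by
        rw [← Complex.normSq_eq_norm_sq, Complex.normSq_apply]
      rw [div_pow, div_pow, ← add_div, div_eq_one_iff_eq (by positivity), h1]; ring
    have hρκ : ((‖w‖ ^ 2 - 1) / (1 + ‖w‖ ^ 2)) ^ 2 + (2 * ‖w‖ / (1 + ‖w‖ ^ 2)) ^ 2 = 1 := by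
      have : 1 + ‖w‖ ^ 2 ≠ 0 := by positivity
      field_simp; ring
    have h := (measurePreserving_comb_gaussianPi (n := n) hρκ).comp
      ((MeasurePreserving.id (gaussianPi n)).prod (measurePreserving_comb_gaussianPi hcs))
    convert h using 1
    funext q
    exact sphComb_eq hw _ _ _

/-- A tail bound with exponent larger than one gives a bound for the expectation. -/
lemma lintegral_le_of_tail_le {Ω : Type*} [MeasurableSpace Ω] {P : Measure Ω}
    [IsProbabilityMeasure P] {g : Ω → ℝ} (hg : Measurable g) (hg0 : ∀ x, 0 ≤ g x) {A q : ℝ}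
    (hA : 0 < A) (hq : 1 < q) (h : ∀ s, 0 < s → P {x | s < g x} ≤ ENNReal.ofReal ((A / s) ^ q)) :
    ∫⁻ x, ENNReal.ofReal (g x) ∂P ≤ ENNReal.ofReal (A * (1 + 1 / (q - 1))) := by
  rw [lintegral_eq_lintegral_meas_lt P (Filter.Eventually.of_forall hg0) hg.aemeasurable,
    ← Set.Ioc_union_Ioi_eq_Ioi hA.le]
  refine (lintegral_union_le _ _ _).trans ?_
  have h1 : ∫⁻ s in Set.Ioc 0 A, P {x | s < g x} ≤ ENNReal.ofReal A := by
    calc ∫⁻ s in Set.Ioc 0 A, P {x | s < g x} ≤ ∫⁻ _ in Set.Ioc 0 A, 1 :=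
          lintegral_mono fun s => prob_le_one
      _ = ENNReal.ofReal A := by simp
  have h2 : ∫⁻ s in Set.Ioi A, P {x | s < g x} ≤ ENNReal.ofReal (A / (q - 1)) := by
    calc ∫⁻ s in Set.Ioi A, P {x | s < g x}
        ≤ ∫⁻ s in Set.Ioi A, ENNReal.ofReal (A ^ q * s ^ (-q)) := by
          refine setLIntegral_mono' measurableSet_Ioi fun s hs => ?_
          have hs0 : 0 < s := hA.trans hs
          refine (h s hs0).trans (le_of_eq ?_)
          rw [Real.div_rpow hA.le hs0.le, Real.rpow_neg hs0.le, div_eq_mul_inv]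
      _ = ENNReal.ofReal (∫ s in Set.Ioi A, A ^ q * s ^ (-q)) := by
          rw [ofReal_integral_eq_lintegral_ofReal]
          · exact (integrableOn_Ioi_rpow_of_lt (by linarith) hA).const_mul _
          · refine (ae_restrict_iff' measurableSet_Ioi).2 (Filter.Eventually.of_forall fun s hs => ?_)
            have hs0 : 0 < s := hA.trans hs
            positivity
      _ = ENNReal.ofReal (A / (q - 1)) := by
          rw [integral_const_mul, integral_Ioi_rpow_of_lt (by linarith) hA]
          congr 1
          have h3 : A ^ q * A ^ (-q + 1) = A := by
            rw [← Real.rpow_add hA, add_neg_cancel_left, Real.rpow_one]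
          have h4 : q - 1 ≠ 0 := by linarith
          have h5 : -q + 1 ≠ 0 := by intro h; apply h4; linarith
          calc A ^ q * (-A ^ (-q + 1) / (-q + 1)) = (A ^ q * A ^ (-q + 1)) / (q - 1) := by
                field_simp; ring
            _ = _ := by rw [h3]
  refine (add_le_add h1 h2).trans (le_of_eq ?_)
  rw [← ENNReal.ofReal_add hA.le (div_nonneg hA.le (by linarith))]
  congr 1
  ring

/-- A small-ball estimate with exponent `b` self-improves to every exponent `a ≤ 1` with
`a < 2 * b`. -/
lemma gaussianPi_small_le_bootstrap {n d : ℕ} (hd : 1 ≤ d) {c : Finset (Fin n) → ℝ}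
    (hc : ∀ S : Finset (Fin n), d < S.card → c S = 0) (hN : 1 ≤ ∑ S, c S ^ 2) {a b B : ℝ}
    (ha : 0 < a) (ha1 : a ≤ 1) (hab : a < 2 * b) (hB : 0 < B)
    (h : ∀ r, 0 < r → (gaussianPi n) {x | |multilin c x| ≤ r ^ d} ≤ ENNReal.ofReal ((B * r) ^ b))
    {r : ℝ} (hr : 0 < r) :
    (gaussianPi n) {x | |multilin c x| ≤ r ^ d} ≤
      ENNReal.ofReal ((sphConst / (4 * Real.pi) * r * B) ^ a * (1 + a / (2 * b - a))) := by
  set μ := gaussianPi n with hμ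
  have hpi := Real.pi_pos
  have hsc := sphConst_pos
  have hd0 : (d : ℝ) ≠ 0 := by positivity
  set F : Set (Fin n → ℝ) := {x | |multilin c x| ≤ r ^ d} with hFdef
  have hF : MeasurableSet F := measurableSet_le (by fun_prop) measurable_const
  have hnull : μ {x | multilin c x = 0} = 0 := by
    have h0 := sq_gaussianPi_small_le hd hc hN le_rfl
    rw [mul_zero] at h0
    have h1 : (μ {x | |multilin c x| ≤ 0 ^ d}).toReal = 0 :=
      pow_eq_zero_iff (two_ne_zero) |>.1 (le_antisymm h0 (sq_nonneg _))
    rw [ENNReal.toReal_eq_zero_iff] at h1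
    have h2 := h1.resolve_right (measure_ne_top _ _)
    refine measure_mono_null (fun x hx => ?_) h2
    have hx : multilin c x = 0 := hx
    simp [hx, zero_pow (by omega : d ≠ 0)]
  set m : (Fin n → ℝ) × (Fin n → ℝ) → ℝ := fun p =>
    (max |multilin c p.1| |multilin c p.2|) ^ (1 / d : ℝ) with hm
  have hmm : Measurable m := by
    refine Measurable.pow_const ?_ _
    exact Measurable.max (by fun_prop) (by fun_prop)
  have hm0 : ∀ p, 0 ≤ m p := fun p => by positivity
  have hgm : Measurable fun p => m p ^ (-a) := hmm.pow_const _
  have htail : ∀ s, 0 < s → (μ.prod μ) {p | s < m p ^ (-a)} ≤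
      ENNReal.ofReal ((B ^ a / s) ^ (2 * b / a)) := fun s hs => by
    set ρ := s ^ (-(1 / a)) with hρ
    have hρ0 : 0 < ρ := Real.rpow_pos_of_pos hs _
    have hsub : {p | s < m p ^ (-a)} ⊆ {x | |multilin c x| ≤ ρ ^ d} ×ˢ
        {x | |multilin c x| ≤ ρ ^ d} := fun p hp => by
      have hp : s < m p ^ (-a) := hp
      have hmp : 0 < m p := by
        refine (hm0 p).lt_of_ne fun h0 => ?_
        rw [← h0, Real.zero_rpow (by linarith)] at hp
        linarith
      have h1 : m p ≤ ρ := by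
        have h2 := Real.rpow_le_rpow_of_nonpos hs hp.le (z := -(1 / a))
          (by have : 0 < 1 / a := by positivity
              linarith)
        rwa [← Real.rpow_mul (hm0 p), show -a * -(1 / a) = 1 by field_simp, Real.rpow_one] at h2
      have h3 : max |multilin c p.1| |multilin c p.2| ≤ ρ ^ d := by
        calc max |multilin c p.1| |multilin c p.2| = m p ^ d := by
              rw [hm]
              simp only
              rw [← Real.rpow_natCast, ← Real.rpow_mul (by positivity), one_div_mul_cancel hd0,
                Real.rpow_one]
          _ ≤ ρ ^ d := by gcongr
      exact ⟨(le_max_left _ _).trans h3, (le_max_right _ _).trans h3⟩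
    refine (measure_mono hsub).trans ?_
    rw [Measure.prod_prod]
    refine (mul_le_mul' (h ρ hρ0) (h ρ hρ0)).trans (le_of_eq ?_)
    rw [← ENNReal.ofReal_mul (by positivity), ← Real.rpow_add (by positivity)]
    congr 1
    have e : B ^ a / s = (B * ρ) ^ a := by
      rw [Real.mul_rpow hB.le hρ0.le, hρ, ← Real.rpow_mul hs.le,
        show -(1 / a) * a = -1 by field_simp, Real.rpow_neg_one, div_eq_mul_inv]
    rw [e, ← Real.rpow_mul (by positivity)]
    congr 1
    field_simp
    ring
  have hint := lintegral_le_of_tail_le hgm (fun p => by have := hm0 p; positivity)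
    (Real.rpow_pos_of_pos hB a) ((one_lt_div ha).2 hab) htail
  have hslice : ∀ X Y Z : Fin n → ℝ, multilin c X ≠ 0 → multilin c Y ≠ 0 →
      logPolarMeasure {p | sphComb (logPolar p) X Y Z ∈ F} ≤
        ENNReal.ofReal (4 * Real.pi) * ENNReal.ofReal ((sphConst / (4 * Real.pi) * r) ^ a) *
          ENNReal.ofReal (m (X, Y) ^ (-a)) := fun X Y Z hX hY => by
    have hX0 := abs_pos.2 hX
    have hM0 : 0 < m (X, Y) := Real.rpow_pos_of_pos (lt_max_of_lt_left hX0) _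
    have h1 : logPolarMeasure {p | sphComb (logPolar p) X Y Z ∈ F} ≤
        ENNReal.ofReal (sphConst * r / m (X, Y)) := by
      simp only [hm]
      rcases le_total |multilin c X| |multilin c Y| with hle | hle
      · rw [max_eq_right hle]
        exact logPolarMeasure_small_le' hd hc X Y Z hY hr.le
      · rw [max_eq_left hle]
        exact logPolarMeasure_small_le hd hc X Y Z hX hr.le
    have h2 : logPolarMeasure {p | sphComb (logPolar p) X Y Z ∈ F} ≤
        ENNReal.ofReal (4 * Real.pi) := by
      rw [← logPolarMeasure_univ]; exact measure_mono (Set.subset_univ _)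
    rw [← ENNReal.ofReal_mul (by positivity), ← ENNReal.ofReal_mul (by positivity)]
    set y := sphConst / (4 * Real.pi) * r / m (X, Y) with hy
    have hy0 : 0 < y := by positivity
    have e1 : 4 * Real.pi * (sphConst / (4 * Real.pi) * r) ^ a * m (X, Y) ^ (-a) =
        4 * Real.pi * y ^ a := by
      rw [hy, Real.div_rpow (by positivity) hM0.le, Real.rpow_neg hM0.le]; ring
    rw [e1]
    rcases le_total y 1 with hle | hle
    · refine h1.trans (ENNReal.ofReal_le_ofReal ?_)
      have e2 : sphConst * r / m (X, Y) = 4 * Real.pi * y := by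
        rw [hy]; field_simp
      rw [e2]
      refine mul_le_mul_of_nonneg_left ?_ (by positivity)
      have := Real.rpow_le_rpow_of_exponent_ge hy0 hle ha1
      rwa [Real.rpow_one] at this
    · refine h2.trans (ENNReal.ofReal_le_ofReal ?_)
      exact le_mul_of_one_le_right (by positivity) (Real.one_le_rpow hle ha.le)
  have hind : Measurable (F.indicator (1 : (Fin n → ℝ) → ENNReal)) := measurable_one.indicator hF
  have hmeas : Measurable (fun z : (ℝ × ℝ) × (Fin n → ℝ) × (Fin n → ℝ) × (Fin n → ℝ) =>
      F.indicator (1 : (Fin n → ℝ) → ENNReal)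
        (sphComb (logPolar z.1) z.2.1 z.2.2.1 z.2.2.2)) := by
    exact hind.comp measurable_sphComb_logPolar_uncurry
  have hlaw : ENNReal.ofReal (4 * Real.pi) * μ F = ∫⁻ p, (∫⁻ q, F.indicator 1
      (sphComb (logPolar p) q.1 q.2.1 q.2.2) ∂(μ.prod (μ.prod μ))) ∂logPolarMeasure := by
    have h1 : ∀ p : ℝ × ℝ, ∫⁻ q, F.indicator 1
        (sphComb (logPolar p) q.1 q.2.1 q.2.2) ∂(μ.prod (μ.prod μ)) = μ F := fun p => by
      rw [(measurePreserving_sphComb (logPolar p)).lintegral_comp hind, lintegral_indicator_one hF]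
    simp_rw [h1]
    rw [lintegral_const, logPolarMeasure_univ, mul_comm]
  rw [lintegral_lintegral_swap hmeas.aemeasurable] at hlaw
  have hae : ∀ᵐ q ∂(μ.prod (μ.prod μ)), ∫⁻ p, F.indicator (1 : (Fin n → ℝ) → ENNReal)
      (sphComb (logPolar p) q.1 q.2.1 q.2.2) ∂logPolarMeasure ≤
        ENNReal.ofReal (4 * Real.pi) * ENNReal.ofReal ((sphConst / (4 * Real.pi) * r) ^ a) *
          ENNReal.ofReal (m (q.1, q.2.1) ^ (-a)) := by
    have hx : ∀ᵐ x ∂μ, multilin c x ≠ 0 := by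
      rw [ae_iff]; simpa using hnull
    have h1 : ∀ᵐ q ∂(μ.prod (μ.prod μ)), multilin c q.1 ≠ 0 :=
      (Measure.quasiMeasurePreserving_fst (μ := μ) (ν := μ.prod μ)).ae hx
    have h2 : ∀ᵐ q ∂(μ.prod (μ.prod μ)), multilin c q.2.1 ≠ 0 :=
      (Measure.quasiMeasurePreserving_snd (μ := μ) (ν := μ.prod μ)).ae
        ((Measure.quasiMeasurePreserving_fst (μ := μ) (ν := μ)).ae hx)
    filter_upwards [h1, h2] with q hq1 hq2
    have hFm : MeasurableSet {p | sphComb (logPolar p) q.1 q.2.1 q.2.2 ∈ F} :=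
      ((measurable_sphComb _ _ _).comp measurable_logPolar) hF
    have e : (fun p => F.indicator (1 : (Fin n → ℝ) → ENNReal)
        (sphComb (logPolar p) q.1 q.2.1 q.2.2)) =
        {p | sphComb (logPolar p) q.1 q.2.1 q.2.2 ∈ F}.indicator 1 := by
      funext w; simp [Set.indicator]
    rw [e, lintegral_indicator_one hFm]
    exact hslice _ _ _ hq1 hq2
  have hmp : MeasurePreserving (fun q : (Fin n → ℝ) × (Fin n → ℝ) × (Fin n → ℝ) => (q.1, q.2.1))
      (μ.prod (μ.prod μ)) (μ.prod μ) :=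
    (MeasurePreserving.id μ).prod (measurePreserving_fst (μ := μ) (ν := μ))
  have hfin : ENNReal.ofReal (4 * Real.pi) * μ F ≤ ENNReal.ofReal (4 * Real.pi) *
      (ENNReal.ofReal ((sphConst / (4 * Real.pi) * r) ^ a) *
        ENNReal.ofReal (B ^ a * (1 + 1 / (2 * b / a - 1)))) := by
    rw [hlaw]
    refine (lintegral_mono_ae hae).trans ?_
    rw [lintegral_const_mul _ (by exact (hgm.comp hmp.measurable).ennreal_ofReal), mul_assoc]
    refine mul_le_mul_right (mul_le_mul_right ?_ _) _
    rw [hmp.lintegral_comp (f := fun p => ENNReal.ofReal (m p ^ (-a))) hgm.ennreal_ofReal]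
    exact hint
  rw [ENNReal.mul_le_mul_iff_right (by simpa using hpi) ENNReal.ofReal_ne_top] at hfin
  refine hfin.trans (le_of_eq ?_)
  rw [← ENNReal.ofReal_mul (by positivity), Real.mul_rpow (by positivity) hB.le, mul_assoc]
  congr 3
  have : 2 * b - a ≠ 0 := by linarith
  field_simp

/-- The small-ball constant. -/
noncomputable def smallBallConst : ℝ :=
  3 * (sphConst / (4 * Real.pi)) * (16 * (sphConst / (4 * Real.pi)) * (3744 * Real.exp 22))

lemma smallBallConst_pos : 0 < smallBallConst := by
  have := Real.pi_pos
  have := sphConst_pos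
  unfold smallBallConst; positivity

/-- A small-ball estimate of Carbery–Wright type for low-degree multilinear polynomials of
Gaussian vectors. -/
theorem gaussianPi_small_le {n d : ℕ} (hd : 1 ≤ d) {c : Finset (Fin n) → ℝ}
    (hc : ∀ S : Finset (Fin n), d < S.card → c S = 0) (hN : 1 ≤ ∑ S, c S ^ 2) {r : ℝ}
    (hr : 0 < r) :
    (gaussianPi n) {x | |multilin c x| ≤ r ^ d} ≤ ENNReal.ofReal (smallBallConst * d * r) := by
  have hpi := Real.pi_pos
  have hsc := sphConst_pos
  have hd1 : (1 : ℝ) ≤ d := by exact_mod_cast hd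
  set C₁ := 3744 * Real.exp 22 * (d : ℝ) with hC₁
  set C₂ := sphConst / (4 * Real.pi) with hC₂
  have hC₁0 : 0 < C₁ := by positivity
  have hC₂0 : 0 < C₂ := by positivity
  have s0 : ∀ r, 0 < r → (gaussianPi n) {x | |multilin c x| ≤ r ^ d} ≤
      ENNReal.ofReal ((C₁ * r) ^ (1 / 2 : ℝ)) := fun r hr => by
    have h := sq_gaussianPi_small_le hd hc hN hr.le
    rw [← Real.sqrt_eq_rpow]
    refine (ENNReal.le_ofReal_iff_toReal_le (measure_ne_top _ _) (Real.sqrt_nonneg _)).2 ?_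
    exact Real.le_sqrt_of_sq_le h
  have s1 : ∀ r, 0 < r → (gaussianPi n) {x | |multilin c x| ≤ r ^ d} ≤
      ENNReal.ofReal ((16 * C₂ * C₁ * r) ^ (3 / 4 : ℝ)) := fun r hr => by
    refine (gaussianPi_small_le_bootstrap hd hc hN (a := 3 / 4) (by norm_num) (by norm_num)
      (by norm_num) hC₁0 s0 hr).trans (ENNReal.ofReal_le_ofReal ?_)
    rw [← hC₂, show 16 * C₂ * C₁ * r = 16 * (C₂ * r * C₁) by ring,
      Real.mul_rpow (x := 16) (y := C₂ * r * C₁) (by norm_num) (by positivity), mul_comm]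
    refine mul_le_mul_of_nonneg_right ?_ (by positivity)
    rw [show (16 : ℝ) = 2 ^ (4 : ℝ) by norm_num, ← Real.rpow_mul (by norm_num)]
    norm_num
  refine (gaussianPi_small_le_bootstrap hd hc hN (a := 1) (by norm_num) (by norm_num)
    (by norm_num) (by positivity) s1 hr).trans (ENNReal.ofReal_le_ofReal (le_of_eq ?_))
  rw [Real.rpow_one, smallBallConst, hC₁, hC₂]
  ring

lemma measurePreserving_update {n : ℕ} (ν : Fin n → Measure ℝ) [∀ i, IsProbabilityMeasure (ν i)]
    (i : Fin n) (ρ : Measure ℝ) [IsProbabilityMeasure ρ] :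
    MeasurePreserving (fun p : (Fin n → ℝ) × ℝ => Function.update p.1 i p.2)
      ((Measure.pi ν).prod ρ) (Measure.pi (Function.update ν i ρ)) := by
  have hup : ∀ j, IsProbabilityMeasure (Function.update ν i ρ j) := fun j => by
    by_cases h : j = i
    · subst h; simpa
    · rw [Function.update_of_ne h]; infer_instance
  have hm : Measurable (fun p : (Fin n → ℝ) × ℝ => Function.update p.1 i p.2) := by
    refine measurable_pi_lambda _ fun j => ?_
    by_cases h : j = i
    · subst h; simpa using measurable_snd
    · simp only [Function.update_of_ne h]; fun_prop
  refine ⟨hm, (Measure.pi_eq fun s hs => ?_).symm⟩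
  rw [Measure.map_apply hm (MeasurableSet.univ_pi hs)]
  have e : (fun p : (Fin n → ℝ) × ℝ => Function.update p.1 i p.2) ⁻¹' Set.univ.pi s =
      (Set.univ.pi (Function.update s i Set.univ)) ×ˢ s i := by
    ext p
    simp only [Set.mem_preimage, Set.mem_pi, Set.mem_univ, true_implies, Set.mem_prod]
    constructor
    · intro h
      refine ⟨fun j => ?_, by simpa using h i⟩
      by_cases hj : j = i
      · subst hj; simp
      · simpa [Function.update_of_ne hj] using h j
    · rintro ⟨h1, h2⟩ j
      by_cases hj : j = i
      · subst hj; simpa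
      · simpa [Function.update_of_ne hj] using h1 j
  rw [e, Measure.prod_prod, Measure.pi_pi, ← Finset.mul_prod_erase _ _ (Finset.mem_univ i),
    ← Finset.mul_prod_erase _ (fun j => Function.update ν i ρ j (s j)) (Finset.mem_univ i)]
  simp only [Function.update_self, measure_univ, one_mul]
  rw [mul_comm]
  congr 1
  refine Finset.prod_congr rfl fun j hj => ?_
  rw [Function.update_of_ne (Finset.ne_of_mem_erase hj),
    Function.update_of_ne (Finset.ne_of_mem_erase hj)]

/-- The coefficients of the part of a multilinear polynomial that is free of the variable `i`. -/
def dropCoeff {n : ℕ} (i : Fin n) (c : Finset (Fin n) → ℝ) : Finset (Fin n) → ℝ := fun S =>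
  if i ∈ S then 0 else c S

/-- The coefficients of the derivative of a multilinear polynomial in the variable `i`. -/
def derivCoeff {n : ℕ} (i : Fin n) (c : Finset (Fin n) → ℝ) : Finset (Fin n) → ℝ := fun S =>
  if i ∈ S then 0 else c (insert i S)

lemma sum_eq_sum_notMem {n : ℕ} (i : Fin n) (g : Finset (Fin n) → ℝ) :
    ∑ S, g S = ∑ S with i ∉ S, (g S + g (insert i S)) := by
  rw [Finset.sum_add_distrib, ← Finset.sum_filter_not_add_sum_filter _ (fun S => i ∈ S)]
  congr 1
  refine Finset.sum_nbij' (fun S => S.erase i) (fun S => insert i S) ?_ ?_ ?_ ?_ ?_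
  · intro S hS; simp
  · intro S hS; simp
  · intro S hS; simp only [Finset.mem_filter, Finset.mem_univ, true_and] at hS
    exact Finset.insert_erase hS
  · intro S hS; simp only [Finset.mem_filter, Finset.mem_univ, true_and] at hS
    exact Finset.erase_insert hS
  · intro S hS; simp only [Finset.mem_filter, Finset.mem_univ, true_and] at hS
    rw [Finset.insert_erase hS]

lemma multilin_eq_drop_add_deriv {n : ℕ} (i : Fin n) (c : Finset (Fin n) → ℝ) (x : Fin n → ℝ) :
    multilin c x = multilin (dropCoeff i c) x + x i * multilin (derivCoeff i c) x := by
  unfold multilin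
  rw [sum_eq_sum_notMem i, Finset.sum_add_distrib, Finset.mul_sum, Finset.sum_filter,
    Finset.sum_filter]
  congr 1 <;> refine Finset.sum_congr rfl fun S _ => ?_ <;> by_cases hi : i ∈ S
  · simp [dropCoeff, hi]
  · simp [dropCoeff, hi]
  · simp [derivCoeff, hi]
  · simp only [derivCoeff, hi, not_false_eq_true, if_true, if_false, Finset.prod_insert hi]; ring

lemma sum_sq_eq_drop_add_deriv {n : ℕ} (i : Fin n) (c : Finset (Fin n) → ℝ) :
    ∑ S, c S ^ 2 = ∑ S, dropCoeff i c S ^ 2 + ∑ S, derivCoeff i c S ^ 2 := by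
  rw [sum_eq_sum_notMem i, Finset.sum_add_distrib, Finset.sum_filter, Finset.sum_filter]
  congr 1 <;> refine Finset.sum_congr rfl fun S _ => ?_ <;> by_cases hi : i ∈ S <;>
    simp [dropCoeff, derivCoeff, hi]

lemma sum_derivCoeff_sq {n : ℕ} (i : Fin n) (c : Finset (Fin n) → ℝ) :
    ∑ S, derivCoeff i c S ^ 2 = ∑ S with i ∈ S, c S ^ 2 := by
  have h1 := sum_sq_eq_drop_add_deriv i c
  rw [← Finset.sum_filter_not_add_sum_filter _ (fun S => i ∈ S)] at h1
  have h2 : ∑ S, dropCoeff i c S ^ 2 = ∑ S with i ∉ S, c S ^ 2 := by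
    rw [Finset.sum_filter]
    refine Finset.sum_congr rfl fun S _ => ?_
    by_cases hi : i ∈ S <;> simp [dropCoeff, hi]
  linarith

lemma multilin_update_of_free {n : ℕ} {i : Fin n} {c : Finset (Fin n) → ℝ}
    (hc : ∀ S, i ∈ S → c S = 0) (x : Fin n → ℝ) (u : ℝ) :
    multilin c (Function.update x i u) = multilin c x := by
  unfold multilin
  refine Finset.sum_congr rfl fun S _ => ?_
  by_cases hi : i ∈ S
  · simp [hc S hi]
  · congr 1
    refine Finset.prod_congr rfl fun j hj => ?_
    rw [Function.update_of_ne]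
    rintro rfl; exact hi hj

lemma multilin_update {n : ℕ} (i : Fin n) (c : Finset (Fin n) → ℝ) (x : Fin n → ℝ) (u : ℝ) :
    multilin c (Function.update x i u) =
      multilin (dropCoeff i c) x + u * multilin (derivCoeff i c) x := by
  rw [multilin_eq_drop_add_deriv i, multilin_update_of_free, multilin_update_of_free,
    Function.update_self]
  · intro S hi; simp [derivCoeff, hi]
  · intro S hi; simp [dropCoeff, hi]

lemma MeasureTheory.MemLp.integrable_pow_mul_pow {Ω : Type*} [MeasurableSpace Ω] {P : Measure Ω}
    [IsFiniteMeasure P] {f g : Ω → ℝ} (hf : MemLp f 4 P) (hg : MemLp g 4 P) {j k : ℕ}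
    (hjk : j + k = 4) : Integrable (fun x => f x ^ j * g x ^ k) P := by
  have h4 : ∀ {h : Ω → ℝ}, MemLp h 4 P → Integrable (fun x => h x ^ 4) P := fun {h} hh => by
    have := MemLp.integrable_norm_pow (p := 4) (by exact_mod_cast hh) (by norm_num)
    refine this.congr (Filter.Eventually.of_forall fun x => ?_)
    simp only [Real.norm_eq_abs]
    exact Even.pow_abs (by decide) _
  refine ((h4 hf).add (h4 hg)).mono'
    ((hf.aestronglyMeasurable.pow j).mul (hg.aestronglyMeasurable.pow k))
    (Filter.Eventually.of_forall fun x => ?_)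
  simp only [Pi.add_apply, norm_mul, norm_pow, Real.norm_eq_abs]
  rw [← Even.pow_abs (n := 4) (by decide) (f x), ← Even.pow_abs (n := 4) (by decide) (g x)]
  have ha := abs_nonneg (f x)
  have hb := abs_nonneg (g x)
  rcases le_total |f x| |g x| with h | h
  · calc |f x| ^ j * |g x| ^ k ≤ |g x| ^ j * |g x| ^ k := by gcongr
      _ = |g x| ^ 4 := by rw [← pow_add, hjk]
      _ ≤ _ := le_add_of_nonneg_left (by positivity)
  · calc |f x| ^ j * |g x| ^ k ≤ |f x| ^ j * |f x| ^ k := by gcongr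
      _ = |f x| ^ 4 := by rw [← pow_add, hjk]
      _ ≤ _ := le_add_of_nonneg_right (by positivity)

lemma HasGaussianMoments.integral_pow_four_le {ν : Measure ℝ} (h : HasGaussianMoments ν)
    (a b : ℝ) : ∫ u, (a + u * b) ^ 4 ∂ν ≤ a ^ 4 + 6 * (a ^ 2 * b ^ 2) + 3 * b ^ 4 := by
  have := h.prob
  have e : ∀ u : ℝ, (a + u * b) ^ 4 = a ^ 4 * u ^ 0 + 4 * a ^ 3 * b * u ^ 1 +
      6 * a ^ 2 * b ^ 2 * u ^ 2 + 4 * a * b ^ 3 * u ^ 3 + b ^ 4 * u ^ 4 := fun u => by ring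
  have i := fun (k : ℕ) (hk : k ≤ 4) (z : ℝ) => (h.integrable_pow hk).const_mul z
  simp_rw [e]
  rw [integral_add, integral_add, integral_add, integral_add]
  · simp_rw [integral_const_mul]
    rw [h.second, h.third]
    simp only [pow_zero, pow_one, h.mean]
    have := mul_le_mul_of_nonneg_left h.fourth (show 0 ≤ b ^ 4 by positivity)
    simp
    linarith
  · exact i 0 (by norm_num) _
  · exact i 1 (by norm_num) _
  · exact (i 0 (by norm_num) _).add (i 1 (by norm_num) _)
  · exact i 2 (by norm_num) _
  · exact ((i 0 (by norm_num) _).add (i 1 (by norm_num) _)).add (i 2 (by norm_num) _)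
  · exact i 3 (by norm_num) _
  · exact (((i 0 (by norm_num) _).add (i 1 (by norm_num) _)).add (i 2 (by norm_num) _)).add
      (i 3 (by norm_num) _)
  · exact i 4 (by norm_num) _

lemma eq_zero_of_sum_sq_eq_zero {n : ℕ} {c : Finset (Fin n) → ℝ} (h : ∑ S, c S ^ 2 = 0) :
    c = 0 := by
  funext S
  have := (Finset.sum_eq_zero_iff_of_nonneg fun S _ => sq_nonneg (c S)).1 h S (Finset.mem_univ S)
  simpa using this

lemma multilin_zero {n : ℕ} (x : Fin n → ℝ) : multilin 0 x = 0 := by simp [multilin]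

section Hypercontractivity

variable {n : ℕ} {ν : Fin n → Measure ℝ}

lemma integral_multilin_pow_four_le_aux (hν : ∀ i, HasGaussianMoments (ν i))
    (s : Finset (Fin n)) : ∀ (d : ℕ)
    (c : Finset (Fin n) → ℝ), (∀ S, c S ≠ 0 → S ⊆ s ∧ S.card ≤ d) →
      ∫ x, multilin c x ^ 4 ∂(Measure.pi ν) ≤ 9 ^ d * (∑ S, c S ^ 2) ^ 2 := by
  have hprob := fun i => (hν i).prob
  induction s using Finset.induction_on with
  | empty =>
    intro d c hc
    have h0 : ∀ S, S ≠ ∅ → c S = 0 := fun S hS => by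
      by_contra h
      exact hS (Finset.subset_empty.1 (hc S h).1)
    have h1 : ∀ x, multilin c x = c ∅ := fun x => by
      unfold multilin
      rw [Finset.sum_eq_single ∅ (fun S _ hS => by rw [h0 S hS, zero_mul]) (by simp)]
      simp
    have h2 : ∑ S, c S ^ 2 = c ∅ ^ 2 :=
      Finset.sum_eq_single ∅ (fun S _ hS => by rw [h0 S hS]; norm_num) (by simp)
    simp_rw [h1]
    rw [h2, ← pow_mul]
    simp only [integral_const, smul_eq_mul, probReal_univ, one_mul]
    exact le_mul_of_one_le_left (by positivity) (one_le_pow₀ (by norm_num))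
  | insert i s his ih =>
    intro d c hc
    set A := multilin (dropCoeff i c) with hA
    set L := multilin (derivCoeff i c) with hL
    set a := ∑ S, dropCoeff i c S ^ 2 with ha
    set b := ∑ S, derivCoeff i c S ^ 2 with hb
    have ha0 : 0 ≤ a := Finset.sum_nonneg fun _ _ => sq_nonneg _
    have hb0 : 0 ≤ b := Finset.sum_nonneg fun _ _ => sq_nonneg _
    have hA4 : ∫ x, A x ^ 4 ∂(Measure.pi ν) ≤ 9 ^ d * a ^ 2 := by
      refine ih d _ fun S hS => ?_
      have hi : i ∉ S := by intro hi; simp [dropCoeff, hi] at hS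
      have h1 : c S ≠ 0 := by simpa [dropCoeff, hi] using hS
      exact ⟨(Finset.subset_insert_iff_of_notMem hi).1 (hc S h1).1, (hc S h1).2⟩
    have hL4 : 9 * ∫ x, L x ^ 4 ∂(Measure.pi ν) ≤ 9 ^ d * b ^ 2 := by
      rcases d with _ | d
      · have h0 : derivCoeff i c = 0 := by
          funext S
          by_cases hi : i ∈ S
          · simp [derivCoeff, hi]
          · simp only [derivCoeff, hi, if_false, Pi.zero_apply]
            by_contra h
            have := (hc _ h).2
            rw [Finset.card_insert_of_notMem hi] at this
            omega
        have h1 : ∀ x, L x = 0 := fun x => by rw [hL, h0, multilin_zero]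
        simp only [h1]
        simp
        positivity
      · have := ih d (derivCoeff i c) fun S hS => by
          have hi : i ∉ S := by intro hi; simp [derivCoeff, hi] at hS
          have h1 : c (insert i S) ≠ 0 := by simpa [derivCoeff, hi] using hS
          obtain ⟨h2, h3⟩ := hc _ h1
          rw [Finset.card_insert_of_notMem hi] at h3
          exact ⟨(Finset.insert_subset_insert_iff hi).1 h2, by omega⟩
        rw [pow_succ]
        linarith
    have mA : MemLp A 4 (Measure.pi ν) := memLp_four_multilin hν _
    have mL : MemLp L 4 (Measure.pi ν) := memLp_four_multilin hν _
    have iA : Integrable (fun x => A x ^ 4) (Measure.pi ν) := by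
      simpa using mA.integrable_pow_mul_pow mL (j := 4) (k := 0) rfl
    have iL : Integrable (fun x => L x ^ 4) (Measure.pi ν) := by
      simpa using mA.integrable_pow_mul_pow mL (j := 0) (k := 4) rfl
    have iAL : Integrable (fun x => A x ^ 2 * L x ^ 2) (Measure.pi ν) :=
      mA.integrable_pow_mul_pow mL rfl
    have iQ : Integrable (fun x => multilin c x ^ 4) (Measure.pi ν) := by
      have := memLp_four_multilin hν c
      simpa using this.integrable_pow_mul_pow this (j := 4) (k := 0) rfl
    have hmix : 6 * ∫ x, A x ^ 2 * L x ^ 2 ∂(Measure.pi ν) ≤ 2 * 9 ^ d * (a * b) := by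
      rcases ha0.eq_or_lt with ha1 | ha1
      · have : ∀ x, A x = 0 := fun x => by
          rw [hA, eq_zero_of_sum_sq_eq_zero ha1.symm, multilin_zero]
        simp [this, ← ha1]
      rcases hb0.eq_or_lt with hb1 | hb1
      · have : ∀ x, L x = 0 := fun x => by
          rw [hL, eq_zero_of_sum_sq_eq_zero hb1.symm, multilin_zero]
        simp [this, ← hb1]
      have hpt : ∀ x, A x ^ 2 * L x ^ 2 ≤ b / (6 * a) * A x ^ 4 + 3 * a / (2 * b) * L x ^ 4 :=
        fun x => by
          have h1 : b / (6 * a) * A x ^ 4 + 3 * a / (2 * b) * L x ^ 4 - A x ^ 2 * L x ^ 2 =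
              (b * A x ^ 2 - 3 * a * L x ^ 2) ^ 2 / (6 * a * b) := by field_simp; ring
          have h2 : 0 ≤ (b * A x ^ 2 - 3 * a * L x ^ 2) ^ 2 / (6 * a * b) := by positivity
          linarith
      have h3 := integral_mono iAL ((iA.const_mul (b / (6 * a))).add
        (iL.const_mul (3 * a / (2 * b)))) hpt
      rw [integral_add' (iA.const_mul (b / (6 * a))) (iL.const_mul (3 * a / (2 * b))),
        integral_const_mul, integral_const_mul] at h3
      have h4 : b / (6 * a) * ∫ x, A x ^ 4 ∂(Measure.pi ν) ≤ b / (6 * a) * (9 ^ d * a ^ 2) :=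
        mul_le_mul_of_nonneg_left hA4 (by positivity)
      have h5 : 3 * a / (2 * b) * ∫ x, L x ^ 4 ∂(Measure.pi ν) ≤
          3 * a / (2 * b) * (9 ^ d * b ^ 2 / 9) :=
        mul_le_mul_of_nonneg_left (by linarith) (by positivity)
      have h6 : b / (6 * a) * (9 ^ d * a ^ 2) + 3 * a / (2 * b) * (9 ^ d * b ^ 2 / 9) =
          9 ^ d * (a * b) / 3 := by field_simp; ring
      linarith
    have hmp := measurePreserving_update ν i (ν i)
    rw [Function.update_eq_self] at hmp
    have e1 : ∫ x, multilin c x ^ 4 ∂(Measure.pi ν) =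
        ∫ p, (A p.1 + p.2 * L p.1) ^ 4 ∂((Measure.pi ν).prod (ν i)) := by
      conv_lhs => rw [← hmp.map_eq]
      rw [integral_map hmp.measurable.aemeasurable (by fun_prop)]
      simp_rw [multilin_update]
      rfl
    have i1 : Integrable (fun p : (Fin n → ℝ) × ℝ => (A p.1 + p.2 * L p.1) ^ 4)
        ((Measure.pi ν).prod (ν i)) := by
      have := hmp.integrable_comp_of_integrable iQ
      refine this.congr (Filter.Eventually.of_forall fun p => ?_)
      simp only [Function.comp, multilin_update]
      rfl
    rw [e1, integral_prod _ i1]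
    refine (integral_mono i1.integral_prod_left ((iA.add (iAL.const_mul 6)).add (iL.const_mul 3))
      fun x => (hν i).integral_pow_four_le (A x) (L x)).trans ?_
    rw [integral_add' (iA.add (iAL.const_mul 6)) (iL.const_mul 3),
      integral_add' iA (iAL.const_mul 6), integral_const_mul, integral_const_mul,
      sum_sq_eq_drop_add_deriv i c]
    have : (0 : ℝ) ≤ 9 ^ d * b ^ 2 := by positivity
    nlinarith

/-- Hypercontractivity: the fourth moment of a low-degree polynomial is controlled by the square of
its second moment. -/
lemma integral_multilin_pow_four_le (hν : ∀ i, HasGaussianMoments (ν i))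
    {d : ℕ} {c : Finset (Fin n) → ℝ}
    (hc : ∀ S : Finset (Fin n), d < S.card → c S = 0) :
    ∫ x, multilin c x ^ 4 ∂(Measure.pi ν) ≤ 9 ^ d * (∑ S, c S ^ 2) ^ 2 :=
  integral_multilin_pow_four_le_aux hν Finset.univ d c fun S hS =>
    ⟨Finset.subset_univ _, not_lt.1 fun h => hS (hc S h)⟩

end Hypercontractivity

/-- `Ψ` is approximated at every point by a cubic polynomial, with error at most `K` times the
fourth power of the distance. -/
def HasCubicApprox (Ψ : ℝ → ℝ) (K : ℝ) : Prop :=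
  ∀ a, ∃ p q s : ℝ, ∀ h, |Ψ (a + h) - (Ψ a + p * h + q * h ^ 2 + s * h ^ 3)| ≤ K * h ^ 4

lemma HasCubicApprox.nonneg {Ψ : ℝ → ℝ} {K : ℝ} (h : HasCubicApprox Ψ K) : 0 ≤ K := by
  obtain ⟨p, q, s, h⟩ := h 0
  have := (abs_nonneg _).trans (h 1)
  simpa using this

lemma HasCubicApprox.exists_abs_integral_sub_le {Ψ : ℝ → ℝ} {K : ℝ} (hΨ : HasCubicApprox Ψ K)
    (hcont : Continuous Ψ) (hb : ∀ x, |Ψ x| ≤ 1) (a : ℝ) :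
    ∃ q, ∀ (ν : Measure ℝ), HasGaussianMoments ν → ∀ b,
      |∫ u, Ψ (a + u * b) ∂ν - (Ψ a + q * b ^ 2)| ≤ 3 * K * b ^ 4 := by
  obtain ⟨p, q, s, h⟩ := hΨ a
  refine ⟨q, fun ν hν b => ?_⟩
  have := hν.prob
  have i := fun (k : ℕ) (hk : k ≤ 4) (z : ℝ) => (hν.integrable_pow hk).const_mul z
  have iΨ : Integrable (fun u => Ψ (a + u * b)) ν :=
    Integrable.of_bound (by fun_prop) 1 (Filter.Eventually.of_forall fun u => by
      simpa using hb (a + u * b))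
  have i1 := i 1 (by norm_num) (p * b)
  have i2 := i 2 (by norm_num) (q * b ^ 2)
  have i3 := i 3 (by norm_num) (s * b ^ 3)
  have i0 := i 0 (by norm_num) (Ψ a)
  have i01 : Integrable (fun u => Ψ a * u ^ 0 + p * b * u ^ 1) ν := i0.add i1
  have i012 : Integrable (fun u => Ψ a * u ^ 0 + p * b * u ^ 1 + q * b ^ 2 * u ^ 2) ν :=
    i01.add i2
  have iP : Integrable
      (fun u => Ψ a * u ^ 0 + p * b * u ^ 1 + q * b ^ 2 * u ^ 2 + s * b ^ 3 * u ^ 3) ν :=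
    i012.add i3
  have e : ∫ u, (Ψ a * u ^ 0 + p * b * u ^ 1 + q * b ^ 2 * u ^ 2 + s * b ^ 3 * u ^ 3) ∂ν =
      Ψ a + q * b ^ 2 := by
    rw [integral_add i012 i3, integral_add i01 i2, integral_add i0 i1]
    simp_rw [integral_const_mul]
    rw [hν.second, hν.third]
    simp [hν.mean]
  rw [← e, ← integral_sub iΨ iP]
  refine (abs_integral_le_integral_abs).trans ?_
  refine (integral_mono (iΨ.sub iP).abs
    (i 4 le_rfl (K * b ^ 4)) fun u => ?_).trans ?_
  · have := h (u * b)
    simp only [Pi.sub_apply]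
    have e1 : Ψ (a + u * b) - (Ψ a * u ^ 0 + p * b * u ^ 1 + q * b ^ 2 * u ^ 2 +
        s * b ^ 3 * u ^ 3) =
        Ψ (a + u * b) - (Ψ a + p * (u * b) + q * (u * b) ^ 2 + s * (u * b) ^ 3) := by ring
    rw [e1]
    exact this.trans (le_of_eq (by ring))
  · rw [integral_const_mul]
    have := mul_le_mul_of_nonneg_left hν.fourth
      (mul_nonneg hΨ.nonneg (show 0 ≤ b ^ 4 by positivity))
    linarith

section Replacement

variable {n : ℕ} {Ψ : ℝ → ℝ} {K : ℝ}

lemma integral_comp_multilin_update {ν : Fin n → Measure ℝ} (hν : ∀ i, HasGaussianMoments (ν i))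
    (hcont : Continuous Ψ) (hb : ∀ x, |Ψ x| ≤ 1) (c : Finset (Fin n) → ℝ) (i : Fin n)
    {ρ : Measure ℝ} (hρ : HasGaussianMoments ρ) :
    Integrable (fun x => ∫ u, Ψ (multilin (dropCoeff i c) x + u * multilin (derivCoeff i c) x) ∂ρ)
        (Measure.pi ν) ∧
      ∫ x, Ψ (multilin c x) ∂(Measure.pi (Function.update ν i ρ)) =
        ∫ x, ∫ u, Ψ (multilin (dropCoeff i c) x + u * multilin (derivCoeff i c) x) ∂ρ
          ∂(Measure.pi ν) := by
  have hprob := fun i => (hν i).prob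
  have := hρ.prob
  have hmp := measurePreserving_update ν i ρ
  have hint : Integrable (fun p : (Fin n → ℝ) × ℝ =>
      Ψ (multilin (dropCoeff i c) p.1 + p.2 * multilin (derivCoeff i c) p.1))
      ((Measure.pi ν).prod ρ) :=
    Integrable.of_bound (by fun_prop) 1 (Filter.Eventually.of_forall fun u => by
      simpa using hb _)
  refine ⟨hint.integral_prod_left, ?_⟩
  rw [← integral_prod _ hint, ← hmp.map_eq, integral_map hmp.measurable.aemeasurable]
  · simp_rw [multilin_update]
  · exact (hcont.measurable.comp (measurable_multilin c)).aestronglyMeasurable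

lemma abs_integral_update_sub_le {d : ℕ} (hd : 1 ≤ d) {ν : Fin n → Measure ℝ}
    (hν : ∀ i, HasGaussianMoments (ν i))
    (hΨ : HasCubicApprox Ψ K) (hcont : Continuous Ψ) (hb : ∀ x, |Ψ x| ≤ 1)
    {c : Finset (Fin n) → ℝ} (hc : ∀ S : Finset (Fin n), d < S.card → c S = 0) (i : Fin n)
    {ρ : Measure ℝ} (hρ : HasGaussianMoments ρ) :
    |∫ x, Ψ (multilin c x) ∂(Measure.pi (Function.update ν i ρ)) -
      ∫ x, Ψ (multilin c x) ∂(Measure.pi ν)| ≤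
      6 * K * (9 ^ (d - 1) * (∑ S with i ∈ S, c S ^ 2) ^ 2) := by
  have hprob := fun i => (hν i).prob
  obtain ⟨i1, e1⟩ := integral_comp_multilin_update hν hcont hb c i hρ
  obtain ⟨i2, e2⟩ := integral_comp_multilin_update hν hcont hb c i (hν i)
  rw [Function.update_eq_self] at e2
  rw [e1, e2, ← integral_sub i1 i2]
  have iL : Integrable (fun x => multilin (derivCoeff i c) x ^ 4) (Measure.pi ν) := by
    have := memLp_four_multilin hν (derivCoeff i c)
    simpa using this.integrable_pow_mul_pow this (j := 4) (k := 0) rfl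
  refine abs_integral_le_integral_abs.trans ((integral_mono (i1.sub i2).abs (iL.const_mul (6 * K))
    fun x => ?_).trans ?_)
  · obtain ⟨q, hq⟩ := hΨ.exists_abs_integral_sub_le hcont hb (multilin (dropCoeff i c) x)
    have h1 := hq ρ hρ (multilin (derivCoeff i c) x)
    have h2 := hq (ν i) (hν i) (multilin (derivCoeff i c) x)
    rw [abs_le] at h1 h2
    simp only [Pi.sub_apply]
    rw [abs_le]
    constructor <;> linarith [h1.1, h1.2, h2.1, h2.2]
  · rw [integral_const_mul, ← sum_derivCoeff_sq]
    refine mul_le_mul_of_nonneg_left (integral_multilin_pow_four_le hν fun S hS => ?_)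
      (by have := hΨ.nonneg; positivity)
    by_cases hi : i ∈ S
    · simp [derivCoeff, hi]
    · simp only [derivCoeff, hi, if_false]
      refine hc _ ?_
      rw [Finset.card_insert_of_notMem hi]
      omega

/-- Lindeberg replacement: exchanging all the laws of the coordinates changes the expectation of a
smooth function of a low-degree polynomial by at most the sum of the squared influences. -/
lemma abs_integral_comp_multilin_sub_le {d : ℕ} (hd : 1 ≤ d) {ν ν' : Fin n → Measure ℝ}
    (hν : ∀ i, HasGaussianMoments (ν i)) (hν' : ∀ i, HasGaussianMoments (ν' i))
    (hΨ : HasCubicApprox Ψ K) (hcont : Continuous Ψ) (hb : ∀ x, |Ψ x| ≤ 1)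
    {c : Finset (Fin n) → ℝ} (hc : ∀ S : Finset (Fin n), d < S.card → c S = 0) :
    |∫ x, Ψ (multilin c x) ∂(Measure.pi ν') - ∫ x, Ψ (multilin c x) ∂(Measure.pi ν)| ≤
      6 * K * 9 ^ (d - 1) * ∑ i, (∑ S with i ∈ S, c S ^ 2) ^ 2 := by
  have key : ∀ s : Finset (Fin n),
      |∫ x, Ψ (multilin c x) ∂(Measure.pi fun i => if i ∈ s then ν' i else ν i) -
        ∫ x, Ψ (multilin c x) ∂(Measure.pi ν)| ≤
      6 * K * 9 ^ (d - 1) * ∑ i ∈ s, (∑ S with i ∈ S, c S ^ 2) ^ 2 := by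
    intro s
    induction s using Finset.induction_on with
    | empty => simp
    | insert i s his ih =>
      have e : (fun j => if j ∈ insert i s then ν' j else ν j) =
          Function.update (fun j => if j ∈ s then ν' j else ν j) i (ν' i) := by
        funext j
        by_cases hj : j = i
        · subst hj; simp
        · simp [hj]
      have hs : ∀ j, HasGaussianMoments (if j ∈ s then ν' j else ν j) := fun j => by
        split_ifs
        exacts [hν' j, hν j]
      rw [e, Finset.sum_insert his]
      have := abs_integral_update_sub_le hd hs hΨ hcont hb hc i (hν' i)
      refine (abs_sub_le _ _ _).trans ((add_le_add this ih).trans (le_of_eq ?_))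
      ring
  simpa using key Finset.univ

end Replacement

lemma sum_influence_sq_le {n d : ℕ} {c : Finset (Fin n) → ℝ} {τ : ℝ}
    (hc : ∀ S : Finset (Fin n), d < S.card → c S = 0)
    (hτ : ∀ i, ∑ S with i ∈ S, c S ^ 2 ≤ τ) (hτ0 : 0 ≤ τ) :
    ∑ i, (∑ S with i ∈ S, c S ^ 2) ^ 2 ≤ τ * (d * ∑ S with S ≠ ∅, c S ^ 2) := by
  have h1 : ∑ i, ∑ S with i ∈ S, c S ^ 2 ≤ d * ∑ S with S ≠ ∅, c S ^ 2 := by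
    have e : ∀ i, ∑ S with i ∈ S, c S ^ 2 = ∑ S, if i ∈ S then c S ^ 2 else 0 :=
      fun i => Finset.sum_filter _ _
    simp_rw [e]
    rw [Finset.sum_comm, Finset.sum_filter, Finset.mul_sum]
    refine Finset.sum_le_sum fun S _ => ?_
    rw [← Finset.sum_filter, Finset.sum_const, nsmul_eq_mul, Finset.filter_univ_mem]
    by_cases hS : S = ∅
    · simp [hS]
    rw [if_pos hS]
    by_cases hdS : d < S.card
    · simp [hc S hdS]
    · have : (S.card : ℝ) ≤ d := by exact_mod_cast not_lt.1 hdS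
      gcongr
  calc ∑ i, (∑ S with i ∈ S, c S ^ 2) ^ 2 ≤ ∑ i, τ * ∑ S with i ∈ S, c S ^ 2 := by
        refine Finset.sum_le_sum fun i _ => ?_
        rw [sq]
        exact mul_le_mul_of_nonneg_right (hτ i) (Finset.sum_nonneg fun _ _ => sq_nonneg _)
    _ = τ * ∑ i, ∑ S with i ∈ S, c S ^ 2 := by rw [Finset.mul_sum]
    _ ≤ _ := mul_le_mul_of_nonneg_left h1 hτ0

lemma iteratedDeriv_smoothTransition_bounded :
    ∃ M : ℝ, ∀ x, |iteratedDeriv 4 Real.smoothTransition x| ≤ M := by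
  have hcont : Continuous (iteratedDeriv 4 Real.smoothTransition) :=
    (Real.smoothTransition.contDiff (n := 4)).continuous_iteratedDeriv 4 le_rfl
  obtain ⟨M, hM⟩ := (isCompact_Icc (a := (0 : ℝ)) (b := 1)).exists_bound_of_continuousOn
    hcont.continuousOn
  refine ⟨max M 0, fun x => ?_⟩
  have hz : ∀ z : ℝ, Real.smoothTransition =ᶠ[nhds x] (fun _ => z) →
      iteratedDeriv 4 Real.smoothTransition x = 0 := fun z hz => by
    rw [hz.iteratedDeriv_eq 4, iteratedDeriv_const]
    simp
  rcases lt_or_ge x 0 with h | h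
  · rw [hz 0]
    · simp
    · filter_upwards [Iio_mem_nhds h] with y hy
      exact Real.smoothTransition.zero_of_nonpos (le_of_lt hy)
  rcases lt_or_ge 1 x with h' | h'
  · rw [hz 1]
    · simp
    · filter_upwards [Ioi_mem_nhds h'] with y hy
      exact Real.smoothTransition.one_of_one_le (le_of_lt hy)
  · exact (hM x ⟨h, h'⟩).trans (le_max_left _ _)

lemma hasCubicApprox_of_iteratedDeriv_le {f : ℝ → ℝ} {M : ℝ} (hf : ContDiff ℝ 4 f)
    (hM : ∀ x, |iteratedDeriv 4 f x| ≤ M) : HasCubicApprox f M := by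
  have hM0 : 0 ≤ M := (abs_nonneg _).trans (hM 0)
  intro a
  refine ⟨iteratedDeriv 1 f a, iteratedDeriv 2 f a / 2, iteratedDeriv 3 f a / 6, fun h => ?_⟩
  rcases eq_or_ne h 0 with rfl | hh
  · simp
  have hne : a ≠ a + h := by simpa using hh
  obtain ⟨y, -, hy⟩ := taylor_mean_remainder_lagrange_iteratedDeriv (n := 3) hne
    (hf.contDiffOn (s := Set.uIcc a (a + h)))
  have hw : ∀ k : ℕ, k ≤ 3 → iteratedDerivWithin k f (Set.uIcc a (a + h)) a = iteratedDeriv k f a :=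
    fun k hk => iteratedDerivWithin_eq_iteratedDeriv (uniqueDiffOn_uIcc hne)
      (hf.contDiffAt.of_le (by exact_mod_cast hk.trans (by norm_num))) Set.left_mem_uIcc
  rw [taylor_within_apply] at hy
  simp only [Finset.sum_range_succ, Finset.sum_range_zero] at hy
  rw [hw 0 (by norm_num), hw 1 (by norm_num), hw 2 (by norm_num), hw 3 (by norm_num)] at hy
  simp only [iteratedDeriv_zero, add_sub_cancel_left, smul_eq_mul, Nat.factorial] at hy
  norm_num at hy
  have e : f (a + h) - (f a + iteratedDeriv 1 f a * h + iteratedDeriv 2 f a / 2 * h ^ 2 +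
      iteratedDeriv 3 f a / 6 * h ^ 3) = iteratedDeriv 4 f y * h ^ 4 / 24 := by
    rw [← hy, iteratedDeriv_one]; ring
  rw [e, abs_div, abs_mul, abs_of_nonneg (show 0 ≤ h ^ 4 by positivity)]
  have h1 := mul_le_mul_of_nonneg_right (hM y) (show 0 ≤ h ^ 4 by positivity)
  have h2 : 0 ≤ M * h ^ 4 := by positivity
  norm_num
  linarith

lemma HasCubicApprox.comp_affine {Ψ : ℝ → ℝ} {K l : ℝ} (h : HasCubicApprox Ψ K) (t : ℝ) :
    HasCubicApprox (fun x => Ψ ((x - t) * l)) (K * l ^ 4) := by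
  intro a
  obtain ⟨p, q, s, h⟩ := h ((a - t) * l)
  refine ⟨p * l, q * l ^ 2, s * l ^ 3, fun y => ?_⟩
  have e : (a + y - t) * l = (a - t) * l + y * l := by ring
  have e1 : Ψ ((a - t) * l + y * l) - (Ψ ((a - t) * l) + p * l * y + q * l ^ 2 * y ^ 2 +
      s * l ^ 3 * y ^ 3) = Ψ ((a - t) * l + y * l) - (Ψ ((a - t) * l) + p * (y * l) +
      q * (y * l) ^ 2 + s * (y * l) ^ 3) := by ring
  simp only
  rw [e, e1]
  exact (h (y * l)).trans (le_of_eq (by ring))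

lemma HasCubicApprox.one_sub {Ψ : ℝ → ℝ} {K : ℝ} (h : HasCubicApprox Ψ K) :
    HasCubicApprox (fun x => 1 - Ψ x) K := by
  intro a
  obtain ⟨p, q, s, h⟩ := h a
  refine ⟨-p, -q, -s, fun y => ?_⟩
  rw [← abs_neg]
  convert h y using 2
  ring

/-- There is a smooth decreasing step from `1` to `0` on the unit interval. -/
lemma exists_smooth_step : ∃ (Ψ : ℝ → ℝ) (K : ℝ), 0 ≤ K ∧ HasCubicApprox Ψ K ∧ Continuous Ψ ∧
    (∀ x, 0 ≤ Ψ x ∧ Ψ x ≤ 1) ∧ (∀ x ≤ 0, Ψ x = 1) ∧ ∀ x, 1 ≤ x → Ψ x = 0 := by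
  obtain ⟨M, hM⟩ := iteratedDeriv_smoothTransition_bounded
  have h := (hasCubicApprox_of_iteratedDeriv_le Real.smoothTransition.contDiff hM).one_sub
  refine ⟨_, M, h.nonneg, h, ?_, fun x => ⟨?_, ?_⟩, fun x hx => ?_, fun x hx => ?_⟩
  · exact continuous_const.sub Real.smoothTransition.continuous
  · linarith [Real.smoothTransition.le_one x]
  · linarith [Real.smoothTransition.nonneg x]
  · simp [Real.smoothTransition.zero_of_nonpos hx]
  · simp [Real.smoothTransition.one_of_one_le hx]

/-- The uniform probability measure on the two booleans. -/
noncomputable def coinMeasure : Measure Bool := (2⁻¹ : ENNReal) • Measure.count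

instance : IsProbabilityMeasure coinMeasure := ⟨by
  rw [coinMeasure, Measure.smul_apply, Measure.count_univ, ENat.card_eq_coe_fintype_card]
  simp [ENNReal.inv_mul_cancel]⟩

/-- The Rademacher law on the line. -/
noncomputable def rademacher : Measure ℝ := coinMeasure.map bR

lemma integral_coinMeasure (g : Bool → ℝ) : ∫ b, g b ∂coinMeasure = (g true + g false) / 2 := by
  rw [integral_fintype (Integrable.of_finite)]
  simp [coinMeasure, measureReal_def]
  ring

lemma integral_rademacher {g : ℝ → ℝ} (hg : Continuous g) :
    ∫ x, g x ∂rademacher = (g 1 + g (-1)) / 2 := by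
  rw [rademacher, integral_map (measurable_of_finite _).aemeasurable hg.aestronglyMeasurable,
    integral_coinMeasure]
  simp [bR]

lemma hasGaussianMoments_rademacher : HasGaussianMoments rademacher where
  prob := Measure.isProbabilityMeasure_map (measurable_of_finite _).aemeasurable
  memLp := by
    rw [rademacher, memLp_map_measure_iff (by fun_prop) (measurable_of_finite _).aemeasurable]
    exact MemLp.of_bound (measurable_of_finite _).aestronglyMeasurable 1
      (Filter.Eventually.of_forall fun b => by cases b <;> simp [bR])
  mean := by rw [integral_rademacher (by fun_prop)]; norm_num
  second := by rw [integral_rademacher (by fun_prop)]; norm_num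
  third := by rw [integral_rademacher (by fun_prop)]; norm_num
  fourth := by rw [integral_rademacher (by fun_prop)]; norm_num

lemma integral_pi_rademacher {n : ℕ} {g : (Fin n → ℝ) → ℝ} (hg : Measurable g) :
    ∫ x, g x ∂(Measure.pi fun _ : Fin n => rademacher) =
      expect fun x : Fin n → Bool => g fun i => bR (x i) := by
  have hm : MeasurePreserving bR coinMeasure rademacher := ⟨measurable_of_finite _, rfl⟩
  have := hasGaussianMoments_rademacher.prob
  have hmp := measurePreserving_pi (fun _ : Fin n => coinMeasure) (fun _ : Fin n => rademacher)
    fun _ => hm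
  rw [← hmp.map_eq, integral_map hmp.measurable.aemeasurable hg.aestronglyMeasurable,
    integral_fintype (Integrable.of_finite)]
  unfold _root_.expect
  rw [Finset.sum_div]
  refine Finset.sum_congr rfl fun x _ => ?_
  rw [measureReal_def, ← Set.univ_pi_singleton x, Measure.pi_pi]
  simp [coinMeasure, div_eq_inv_mul]

section Sandwich

variable {Ω : Type*} [MeasurableSpace Ω] {P : Measure Ω} [IsProbabilityMeasure P] {f : Ω → ℝ}
  {Ψ : ℝ → ℝ}

lemma integrable_comp_affine (hf : Measurable f) (hcont : Continuous Ψ)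
    (hΨ : ∀ x, 0 ≤ Ψ x ∧ Ψ x ≤ 1) (t l : ℝ) : Integrable (fun x => Ψ ((f x - t) * l)) P :=
  Integrable.of_bound (by fun_prop) 1 (Filter.Eventually.of_forall fun x => by
    rw [Real.norm_eq_abs, abs_of_nonneg (hΨ _).1]; exact (hΨ _).2)

lemma measureReal_le_integral_comp (hf : Measurable f) (hcont : Continuous Ψ)
    (hΨ : ∀ x, 0 ≤ Ψ x ∧ Ψ x ≤ 1) (h1 : ∀ x ≤ 0, Ψ x = 1) (t : ℝ) {l : ℝ} (hl : 0 < l) :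
    P.real {x | f x ≤ t} ≤ ∫ x, Ψ ((f x - t) * l) ∂P := by
  have hm : MeasurableSet {x | f x ≤ t} := measurableSet_le hf measurable_const
  rw [← integral_indicator_one hm]
  refine integral_mono ((integrable_const (1 : ℝ)).indicator hm)
    (integrable_comp_affine hf hcont hΨ t l) fun x => ?_
  by_cases hx : f x ≤ t
  · rw [Set.indicator_of_mem (by exact hx),
      h1 _ (mul_nonpos_of_nonpos_of_nonneg (by linarith) hl.le)]
    rfl
  · rw [Set.indicator_of_notMem (by exact hx)]
    exact (hΨ _).1

lemma integral_comp_le_measureReal (hf : Measurable f) (hcont : Continuous Ψ)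
    (hΨ : ∀ x, 0 ≤ Ψ x ∧ Ψ x ≤ 1) (h0 : ∀ x, 1 ≤ x → Ψ x = 0) (t : ℝ) {r : ℝ} (hr : 0 < r) :
    ∫ x, Ψ ((f x - t) * r⁻¹) ∂P ≤ P.real {x | f x ≤ t + r} := by
  have hm : MeasurableSet {x | f x ≤ t + r} := measurableSet_le hf measurable_const
  rw [← integral_indicator_one hm]
  refine integral_mono (integrable_comp_affine hf hcont hΨ t r⁻¹)
    ((integrable_const (1 : ℝ)).indicator hm) fun x => ?_
  by_cases hx : f x ≤ t + r
  · rw [Set.indicator_of_mem (by exact hx)]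
    exact (hΨ _).2
  · rw [Set.indicator_of_notMem (by exact hx), h0]
    rw [← div_eq_mul_inv, le_div_iff₀ hr]
    linarith

end Sandwich

lemma measureReal_le_add_of_strip {Ω : Type*} [MeasurableSpace Ω] {P : Measure Ω}
    [IsProbabilityMeasure P] {f : Ω → ℝ} {t r a b : ℝ} (ha : t - r ≤ a) (hb : b ≤ t + r) :
    P.real {x | f x ≤ b} ≤ P.real {x | f x ≤ a} + P.real {x | |f x - t| ≤ r} := by
  refine (measureReal_mono fun x hx => ?_).trans (measureReal_union_le _ _)
  simp only [Set.mem_ofPred_eq, Set.mem_union] at hx ⊢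
  by_cases h : f x ≤ a
  · exact Or.inl h
  · refine Or.inr (abs_le.2 ⟨?_, ?_⟩) <;> linarith

lemma gaussianPi_strip_le {n d : ℕ} (hd : 1 ≤ d) {c : Finset (Fin n) → ℝ}
    (hc : ∀ S : Finset (Fin n), d < S.card → c S = 0)
    (hN : ∑ S with S ≠ ∅, c S ^ 2 = 1) (t : ℝ) {r : ℝ} (hr : 0 < r) :
    (gaussianPi n).real {x | |multilin c x - t| ≤ r ^ d} ≤ smallBallConst * d * r := by
  have hN' : 1 ≤ ∑ S, Function.update c ∅ (c ∅ - t) S ^ 2 := by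
    rw [← hN, Finset.sum_filter]
    refine Finset.sum_le_sum fun S _ => ?_
    by_cases hS : S = ∅
    · simp [hS, sq_nonneg]
    · simp [hS]
  have hc' : ∀ S : Finset (Fin n), d < S.card → Function.update c ∅ (c ∅ - t) S = 0 := by
    intro S hS
    have : S ≠ ∅ := by rintro rfl; simp at hS
    rw [Function.update_of_ne this, hc S hS]
  have e : ∀ x, multilin (Function.update c ∅ (c ∅ - t)) x = multilin c x - t := fun x => by
    unfold multilin
    rw [← Finset.add_sum_erase _ _ (Finset.mem_univ ∅),
      ← Finset.add_sum_erase _ (fun S => c S * ∏ i ∈ S, x i) (Finset.mem_univ ∅)]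
    have : ∑ S ∈ Finset.univ.erase ∅, Function.update c ∅ (c ∅ - t) S * ∏ i ∈ S, x i =
        ∑ S ∈ Finset.univ.erase ∅, c S * ∏ i ∈ S, x i :=
      Finset.sum_congr rfl fun S hS => by rw [Function.update_of_ne (Finset.ne_of_mem_erase hS)]
    rw [this]
    simp
  have h := gaussianPi_small_le hd hc' hN' hr
  simp_rw [e] at h
  exact ENNReal.toReal_le_of_le_ofReal
    (by have := smallBallConst_pos; positivity) h

lemma mul_nine_pow_le {d : ℕ} (hd : 1 ≤ d) : (d : ℝ) * 9 ^ (d - 1) ≤ 10 ^ d := by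
  obtain ⟨k, rfl⟩ := Nat.exists_eq_add_of_le' hd
  simp only [Nat.add_sub_cancel]
  have h : ((k : ℝ) + 1) * 9 ^ k ≤ 10 * 10 ^ k := by
    induction k with
    | zero => norm_num
    | succ k ih =>
      have h9 : (9 : ℝ) ^ k ≤ 10 ^ k := by gcongr; norm_num
      have ih := ih (by omega)
      push_cast
      rw [pow_succ, pow_succ]
      have h10 : (0 : ℝ) < 10 ^ k := by positivity
      nlinarith
  push_cast
  rw [pow_succ]
  linarith

/-- The distribution functions of a low-degree polynomial of signs and of Gaussians are close, with
a free smoothing scale `r`. -/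
lemma abs_cdf_sub_le {Ψ : ℝ → ℝ} {K : ℝ} (hΨ : HasCubicApprox Ψ K) (hcont : Continuous Ψ)
    (hb : ∀ x, 0 ≤ Ψ x ∧ Ψ x ≤ 1) (h1 : ∀ x ≤ 0, Ψ x = 1) (h0 : ∀ x, 1 ≤ x → Ψ x = 0)
    {n d : ℕ} (hd : 1 ≤ d) {c : Finset (Fin n) → ℝ}
    (hc : ∀ S : Finset (Fin n), d < S.card → c S = 0)
    (hN : ∑ S with S ≠ ∅, c S ^ 2 = 1) {τ : ℝ} (hτ : ∀ i, ∑ S with i ∈ S, c S ^ 2 ≤ τ)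
    (hτ0 : 0 ≤ τ) (t : ℝ) {r : ℝ} (hr : 0 < r) :
    |(Measure.pi fun _ : Fin n => rademacher).real {x | multilin c x ≤ t} -
      (gaussianPi n).real {x | multilin c x ≤ t}| ≤
      6 * K * ((r ^ d)⁻¹ ^ 4 * (10 ^ d * τ)) + smallBallConst * d * r := by
  have hradp := hasGaussianMoments_rademacher.prob
  have hgp := isProbabilityMeasure_gaussianPi (n := n)
  have hrd : 0 < r ^ d := by positivity
  have hl : 0 < (r ^ d)⁻¹ := by positivity
  have hE : ∀ s, |∫ x, Ψ ((multilin c x - s) * (r ^ d)⁻¹)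
        ∂(Measure.pi fun _ : Fin n => rademacher) -
      ∫ x, Ψ ((multilin c x - s) * (r ^ d)⁻¹) ∂(gaussianPi n)| ≤
      6 * K * ((r ^ d)⁻¹ ^ 4 * (10 ^ d * τ)) := fun s => by
    have h := abs_integral_comp_multilin_sub_le hd (hasGaussianMoments_gaussianPi (n := n))
      (fun _ : Fin n => hasGaussianMoments_rademacher)
      (hΨ.comp_affine (l := (r ^ d)⁻¹) s) (by fun_prop)
      (fun x => by rw [abs_of_nonneg (hb _).1]; exact (hb _).2) hc
    refine h.trans ?_
    have h2 := sum_influence_sq_le hc hτ hτ0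
    rw [hN, mul_one] at h2
    have hK := hΨ.nonneg
    have h3 := mul_le_mul_of_nonneg_right (mul_nine_pow_le hd) hτ0
    calc 6 * (K * (r ^ d)⁻¹ ^ 4) * 9 ^ (d - 1) * ∑ i, (∑ S with i ∈ S, c S ^ 2) ^ 2
        ≤ 6 * (K * (r ^ d)⁻¹ ^ 4) * 9 ^ (d - 1) * (τ * d) := by gcongr
      _ = 6 * K * ((r ^ d)⁻¹ ^ 4 * (d * 9 ^ (d - 1) * τ)) := by ring
      _ ≤ _ := by gcongr
  have hm := measurable_multilin c
  have hstrip := gaussianPi_strip_le hd hc hN t hr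
  rw [abs_le]
  constructor
  · have a1 := integral_comp_le_measureReal (P := Measure.pi fun _ : Fin n => rademacher)
      hm hcont hb h0 (t - r ^ d) hrd
    rw [sub_add_cancel] at a1
    have a2 := measureReal_le_integral_comp (P := gaussianPi n) hm hcont hb h1 (t - r ^ d) hl
    have a3 := measureReal_le_add_of_strip (P := gaussianPi n) (f := multilin c)
      (t := t) (r := r ^ d) le_rfl (show t ≤ t + r ^ d by linarith)
    have := (abs_le.1 (hE (t - r ^ d))).1
    linarith
  · have a1 := measureReal_le_integral_comp (P := Measure.pi fun _ : Fin n => rademacher)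
      hm hcont hb h1 t hl
    have a2 := integral_comp_le_measureReal (P := gaussianPi n) hm hcont hb h0 t hrd
    have a3 := measureReal_le_add_of_strip (P := gaussianPi n) (f := multilin c)
      (t := t) (r := r ^ d) (show t - r ^ d ≤ t by linarith) le_rfl
    have := (abs_le.1 (hE t)).2
    linarith

lemma expect_ite_eq_measureReal {n : ℕ} (c : Finset (Fin n) → ℝ) (t : ℝ) :
    (expect fun x : Fin n → Bool =>
        if (∑ S : Finset (Fin n), c S * chi S x) ≤ t then (1 : ℝ) else 0) =
      (Measure.pi fun _ : Fin n => rademacher).real {x | multilin c x ≤ t} := by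
  have hm : MeasurableSet {x | multilin c x ≤ t} :=
    measurableSet_le (measurable_multilin c) measurable_const
  have hm1 : Measurable ({x | multilin c x ≤ t}.indicator (1 : (Fin n → ℝ) → ℝ)) :=
    measurable_one.indicator hm
  rw [← integral_indicator_one hm, integral_pi_rademacher hm1]
  congr 1

lemma pos_of_influence_le {n : ℕ} {c : Finset (Fin n) → ℝ} {τ : ℝ}
    (hN : ∑ S with S ≠ ∅, c S ^ 2 = 1) (hτ : ∀ i, ∑ S with i ∈ S, c S ^ 2 ≤ τ) : 0 < τ := by
  by_contra h
  have : ∑ S with S ≠ ∅, c S ^ 2 = 0 := by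
    refine Finset.sum_eq_zero fun S hS => ?_
    obtain ⟨i, hi⟩ := Finset.nonempty_iff_ne_empty.2 (Finset.mem_filter.1 hS).2
    have h1 : c S ^ 2 ≤ ∑ S with i ∈ S, c S ^ 2 :=
      Finset.single_le_sum (f := fun S => c S ^ 2) (fun S _ => sq_nonneg (c S))
        (Finset.mem_filter.2 ⟨Finset.mem_univ S, hi⟩)
    exact le_antisymm (h1.trans ((hτ i).trans (not_lt.1 h))) (sq_nonneg _)
  linarith

/-- **Invariance principle** (Mossel–O'Donnell–Oleszkiewicz, cdf version). There is a
universal constant `C > 0` such that for every multilinear polynomial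
`Q = ∑_{|S| ≤ d} c_S ∏_{i∈S} uᵢ` (`d ≥ 1`) with `∑_{S ≠ ∅} c_S² = 1` and maximum
influence `τ`, and every `t ∈ ℝ`,
`|Pr[Q(X) ≤ t] − Pr[Q(G) ≤ t]| ≤ C · d · (10^d · τ)^{1/(4d+1)}`, where `X` is uniform on
the cube `{-1,1}ⁿ` and `G` is a standard Gaussian vector. -/
theorem invariance_principle :
    ∃ C : ℝ, 0 < C ∧
      ∀ (n d : ℕ), 1 ≤ d →
      ∀ (c : Finset (Fin n) → ℝ),
        (∀ S : Finset (Fin n), d < S.card → c S = 0) →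
        (∑ S ∈ univ.filter (fun S : Finset (Fin n) => S ≠ ∅), c S ^ 2 = 1) →
      ∀ τ : ℝ,
        IsGreatest (Set.range fun i : Fin n =>
          ∑ S ∈ univ.filter (fun S : Finset (Fin n) => i ∈ S), c S ^ 2) τ →
      ∀ t : ℝ,
        |(expect fun x : Fin n → Bool =>
            if (∑ S : Finset (Fin n), c S * chi S x) ≤ t then (1 : ℝ) else 0) -
          ((gaussianPi n) {g | (∑ S : Finset (Fin n), c S * ∏ i ∈ S, g i) ≤ t}).toReal| ≤
        C * d * ((10 : ℝ) ^ d * τ) ^ ((1 : ℝ) / (4 * d + 1)) := by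
  obtain ⟨Ψ, K, hK, hΨ, hcont, hb, h1, h0⟩ := exists_smooth_step
  have hs := smallBallConst_pos
  refine ⟨smallBallConst + 6 * K, by positivity, ?_⟩
  intro n d hd c hc hN τ hτ t
  have hτ' : ∀ i, ∑ S with i ∈ S, c S ^ 2 ≤ τ := fun i => hτ.2 ⟨i, rfl⟩
  have hτ0 := pos_of_influence_le hN hτ'
  have hT : 0 < (10 : ℝ) ^ d * τ := by positivity
  have h := abs_cdf_sub_le hΨ hcont hb h1 h0 hd hc hN hτ' hτ0.le t
    (Real.rpow_pos_of_pos hT ((1 : ℝ) / (4 * d + 1)))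
  rw [expect_ite_eq_measureReal]
  refine h.trans ?_
  set T := (10 : ℝ) ^ d * τ
  set r := T ^ ((1 : ℝ) / (4 * d + 1)) with hr
  have hr0 : 0 < r := Real.rpow_pos_of_pos hT _
  have hTr : T = r ^ (4 * d + 1) := by
    rw [hr, ← Real.rpow_natCast, ← Real.rpow_mul hT.le]
    push_cast
    rw [one_div_mul_cancel (by positivity), Real.rpow_one]
  have e : (r ^ d)⁻¹ ^ 4 * T = r := by
    rw [hTr, inv_pow, ← pow_mul, mul_comm d 4, pow_succ]
    field_simp
  rw [e]
  have hd1 : (1 : ℝ) ≤ d := by exact_mod_cast hd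
  have : 6 * K * r ≤ 6 * K * d * r := by
    have := mul_le_mul_of_nonneg_left hd1 (show 0 ≤ 6 * K * r by positivity)
    linarith
  linarith
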